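/- There exist μ₀ > 0 and c > 0 such that for every μ ∈ (0, μ₀) there is an energy value h with |h| ≤ cμ for which the planar circular restricted three-body problem with mass ratio μ has: (a) a parabolic ejection orbit, i.e. a solution (q(t), p(t)) defined on an interval (t₀, +∞) with H(q(t),p(t);μ) = h, lim_{t→t₀⁺} q(t) = (−μ, 0), ‖q(t)‖ → +∞ and ‖p(t)‖ → 0 as t → +∞; and (b) a parabolic collision orbit, i.e. a solution defined on an interval (−∞, t₁) with the same energy h, lim_{t→t₁⁻} q(t) = (−μ, 0), ‖q(t)‖ → +∞ and ‖p(t)‖ → 0 as t → −∞. -/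

import Mathlib

open Real Filter MeasureTheory
open scoped Topology

/-- Euclidean norm of a planar vector given by its components. -/
noncomputable def nrm2 (x y : ℝ) : ℝ := Real.sqrt (x ^ 2 + y ^ 2)

/-- Distance from `(x,y)` to the first (massive) primary, located at `(-μ,0)`. -/
noncomputable def dS (μ x y : ℝ) : ℝ := Real.sqrt ((x + μ) ^ 2 + y ^ 2)

/-- Distance from `(x,y)` to the second primary, located at `(1-μ,0)`. -/
noncomputable def dJ (μ x y : ℝ) : ℝ := Real.sqrt ((x - (1 - μ)) ^ 2 + y ^ 2)

/-- `(q₁,q₂,p₁,p₂)` is a solution of the planar circular restricted three-body problem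
with mass ratio `μ` on the set `I` of times: it avoids the two singularities and satisfies
Hamilton's equations `q̇ = ∂H/∂p`, `ṗ = -∂H/∂q` for the Hamiltonian
`H(q,p;μ) = ‖p‖²/2 - q₁p₂ + q₂p₁ - (1-μ)/‖q+(μ,0)‖ - μ/‖q-(1-μ,0)‖`,
whose partial derivatives have been computed explicitly. -/
def IsPCRTBPSol (μ : ℝ) (I : Set ℝ) (q1 q2 p1 p2 : ℝ → ℝ) : Prop :=
  ∀ t ∈ I,
    ((q1 t, q2 t) ≠ (-μ, 0) ∧ (q1 t, q2 t) ≠ (1 - μ, 0)) ∧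
    HasDerivAt q1 (p1 t + q2 t) t ∧
    HasDerivAt q2 (p2 t - q1 t) t ∧
    HasDerivAt p1 (p2 t - (1 - μ) * (q1 t + μ) / (dS μ (q1 t) (q2 t)) ^ 3
        - μ * (q1 t - (1 - μ)) / (dJ μ (q1 t) (q2 t)) ^ 3) t ∧
    HasDerivAt p2 (-(p1 t) - (1 - μ) * (q2 t) / (dS μ (q1 t) (q2 t)) ^ 3
        - μ * (q2 t) / (dJ μ (q1 t) (q2 t)) ^ 3) t


/-- The Hamiltonian of the PCRTBP in rotating Cartesian coordinates. -/
noncomputable def Ham (μ q1 q2 p1 p2 : ℝ) : ℝ :=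
  (p1 ^ 2 + p2 ^ 2) / 2 - q1 * p2 + q2 * p1 - (1 - μ) / dS μ q1 q2 - μ / dJ μ q1 q2

open scoped ComplexConjugate

lemma abs_max_norm_sub_le {E : Type*} [NormedAddCommGroup E] (R : ℝ) (x y : E) :
    |max R ‖y‖ - max R ‖x‖| ≤ ‖x - y‖ := by
  refine (abs_max_sub_max_le_max R ‖y‖ R ‖x‖).trans ?_
  rw [sub_self, abs_zero, max_eq_right (abs_nonneg _), norm_sub_rev]
  exact abs_norm_sub_norm_le y x

section Retraction

variable {E : Type*} [NormedAddCommGroup E] [NormedSpace ℝ E]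

/-- The radial retraction of a normed space onto the closed ball of radius `R`. -/
noncomputable def radialRetract (R : ℝ) (x : E) : E := (R / max R ‖x‖) • x

lemma radialRetract_of_le {R : ℝ} (hR : 0 < R) {x : E} (hx : ‖x‖ ≤ R) :
    radialRetract R x = x := by
  rw [radialRetract, max_eq_left hx, div_self hR.ne', one_smul]

lemma norm_radialRetract_eq {R : ℝ} (hR : 0 < R) (x : E) :
    ‖radialRetract R x‖ = R * (‖x‖ / max R ‖x‖) := by
  have hm : 0 < max R ‖x‖ := lt_max_of_lt_left hR
  rw [radialRetract, norm_smul, Real.norm_of_nonneg (by positivity)]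
  ring

lemma norm_radialRetract_le {R : ℝ} (hR : 0 < R) (x : E) : ‖radialRetract R x‖ ≤ R := by
  have hm : 0 < max R ‖x‖ := lt_max_of_lt_left hR
  rw [norm_radialRetract_eq hR]
  have : ‖x‖ / max R ‖x‖ ≤ 1 := (div_le_one hm).2 (le_max_right _ _)
  nlinarith

lemma norm_radialRetract_le_norm {R : ℝ} (hR : 0 < R) (x : E) :
    ‖radialRetract R x‖ ≤ ‖x‖ := by
  have hm : 0 < max R ‖x‖ := lt_max_of_lt_left hR
  rw [radialRetract, norm_smul, Real.norm_of_nonneg (by positivity)]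
  have : R / max R ‖x‖ ≤ 1 := (div_le_one hm).2 (le_max_left _ _)
  nlinarith [norm_nonneg x]

lemma lipschitzWith_radialRetract {R : ℝ} (hR : 0 < R) :
    LipschitzWith 2 (radialRetract R : E → E) := by
  refine LipschitzWith.of_dist_le_mul fun x y => ?_
  rw [dist_eq_norm, dist_eq_norm]
  set m := max R ‖x‖ with hm_def
  set n := max R ‖y‖ with hn_def
  have hm : 0 < m := lt_max_of_lt_left hR
  have hn : 0 < n := lt_max_of_lt_left hR
  have hsplit : radialRetract R x - radialRetract R y
      = (R / m) • (x - y) + ((n - m) * (R / m)) • ((1 / n) • y) := by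
    rw [radialRetract, radialRetract, ← hm_def, ← hn_def, smul_smul, smul_sub, sub_add,
      ← sub_smul]
    congr 2
    field_simp
    ring
  have h1 : R / m ≤ 1 := (div_le_one hm).2 (le_max_left _ _)
  have h0 : 0 ≤ R / m := by positivity
  have hy : ‖(1 / n) • y‖ ≤ 1 := by
    rw [norm_smul, Real.norm_of_nonneg (by positivity), one_div, inv_mul_le_iff₀ hn, mul_one]
    exact le_max_right _ _
  rw [hsplit]
  refine (norm_add_le _ _).trans ?_
  rw [norm_smul, norm_smul _ ((1 / n) • y), Real.norm_of_nonneg h0, norm_mul,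
    Real.norm_of_nonneg h0, Real.norm_eq_abs]
  have h2 : |n - m| ≤ ‖x - y‖ := abs_max_norm_sub_le R x y
  have h3 : |n - m| * (R / m) * ‖(1 / n) • y‖ ≤ ‖x - y‖ * 1 * 1 := by gcongr
  have h4 : R / m * ‖x - y‖ ≤ 1 * ‖x - y‖ := by gcongr
  push_cast
  linarith

end Retraction

section GlobalFlow

variable {E : Type*} [NormedAddCommGroup E] [NormedSpace ℝ E]

lemma exists_solution_of_bounded [CompleteSpace E] {F : E → E} {K : NNReal}
    (hF : LipschitzWith K F) {L : ℝ}
    (hL : ∀ x, ‖F x‖ ≤ L) (x₀ : E) {T : ℝ} (hT : 0 ≤ T) :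
    ∃ x : ℝ → E, x 0 = x₀ ∧
      ∀ t ∈ Set.Icc (-T) T, HasDerivWithinAt x (F (x t)) (Set.Icc (-T) T) t := by
  have hL0 : 0 ≤ L := (norm_nonneg _).trans (hL 0)
  have hpl : IsPicardLindelof (fun _ => F) (⟨0, by constructor <;> linarith⟩ : Set.Icc (-T) T) x₀
      (⟨L * T, by positivity⟩ : NNReal) 0 ⟨L, hL0⟩ K := by
    refine IsPicardLindelof.of_time_independent (fun x _ => hL x) hF.lipschitzOnWith ?_
    change L * max (T - 0) (0 - -T) ≤ L * T - 0
    simp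
  obtain ⟨x, hx0, hx⟩ := hpl.exists_eq_forall_mem_Icc_hasDerivWithinAt₀
  exact ⟨x, hx0, hx⟩

lemma dist_le_of_solutions {F : E → E} {K : NNReal} (hF : LipschitzWith K F) {x y : ℝ → E}
    (hx : ∀ t, HasDerivAt x (F (x t)) t) (hy : ∀ t, HasDerivAt y (F (y t)) t) (t : ℝ) :
    dist (x t) (y t) ≤ dist (x 0) (y 0) * Real.exp (K * |t|) := by
  rcases le_total 0 t with ht | ht
  · rw [abs_of_nonneg ht]
    have := dist_le_of_trajectories_ODE (v := fun _ => F) (a := 0) (b := t) (fun _ => hF)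
      (fun s _ => (hx s).continuousAt.continuousWithinAt)
      (fun s _ => (hx s).hasDerivWithinAt)
      (fun s _ => (hy s).continuousAt.continuousWithinAt)
      (fun s _ => (hy s).hasDerivWithinAt) le_rfl t ⟨ht, le_rfl⟩
    rwa [sub_zero] at this
  · have hneg : ∀ z : ℝ → E, (∀ s, HasDerivAt z (F (z s)) s) →
        ∀ s, HasDerivAt (fun s => z (-s)) (-(F (z (-s)))) s := by
      intro z hz s
      simpa [Function.comp_def] using (hz (-s)).scomp s (hasDerivAt_neg s)
    have := dist_le_of_trajectories_ODE (v := fun _ u => -F u) (a := 0) (b := -t)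
      (f := fun s => x (-s)) (g := fun s => y (-s)) (fun _ => hF.neg)
      (fun s _ => (hneg x hx s).continuousAt.continuousWithinAt)
      (fun s _ => (hneg x hx s).hasDerivWithinAt)
      (fun s _ => (hneg y hy s).continuousAt.continuousWithinAt)
      (fun s _ => (hneg y hy s).hasDerivWithinAt) le_rfl (-t) ⟨by linarith, le_rfl⟩
    simpa [abs_of_nonpos ht] using this

lemma norm_le_of_linear_growth {x x' : ℝ → E} {K c T : ℝ} (hK : 0 ≤ K) (hc : 0 ≤ c)
    (hx : ∀ t ∈ Set.Icc 0 T, HasDerivWithinAt x (x' t) (Set.Icc 0 T) t)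
    (hb : ∀ t ∈ Set.Icc 0 T, ‖x' t‖ ≤ K * ‖x t‖ + c) :
    ∀ t ∈ Set.Icc 0 T, ‖x t‖ ≤ gronwallBound ‖x 0‖ K c T := by
  intro t ht
  have := norm_le_gronwallBound_of_norm_deriv_right_le (f' := x') (δ := ‖x 0‖) (K := K)
    (ε := c) (fun s hs => (hx s hs).continuousWithinAt)
    (fun s hs => (hx s ⟨hs.1, hs.2.le⟩).mono_of_mem_nhdsWithin
      (Icc_mem_nhdsGE_of_mem hs)) le_rfl
    (fun s hs => hb s ⟨hs.1, hs.2.le⟩) t ht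
  refine this.trans (gronwallBound_mono (norm_nonneg _) hc hK ?_)
  linarith [ht.2]

lemma exists_solution_Ioo [CompleteSpace E] {F : E → E} {K : NNReal} (hF : LipschitzWith K F)
    (x₀ : E) {T : ℝ}
    (hT : 0 ≤ T) :
    ∃ x : ℝ → E, x 0 = x₀ ∧ ∀ t ∈ Set.Ioo (-T) T, HasDerivAt x (F (x t)) t := by
  set R : ℝ := max 1 (gronwallBound ‖x₀‖ K ‖F 0‖ T) with hR_def
  have hR : 0 < R := lt_max_of_lt_left one_pos
  have hgrow : ∀ y, ‖F y‖ ≤ K * ‖y‖ + ‖F 0‖ := by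
    intro y
    have := hF.dist_le_mul y 0
    rw [dist_eq_norm, dist_zero_right] at this
    linarith [norm_le_norm_add_norm_sub' (F y) (F 0)]
  have hgrow' : ∀ y, ‖F (radialRetract R y)‖ ≤ K * ‖y‖ + ‖F 0‖ := fun y =>
    (hgrow _).trans (by gcongr; exact norm_radialRetract_le_norm hR y)
  obtain ⟨x, hx0, hx⟩ := exists_solution_of_bounded (F := fun y => F (radialRetract R y))
    (hF.comp (lipschitzWith_radialRetract hR)) (L := K * R + ‖F 0‖)
    (fun y => (hgrow _).trans (by gcongr; exact norm_radialRetract_le hR y)) x₀ hT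
  have hpos : ∀ t ∈ Set.Icc 0 T, ‖x t‖ ≤ gronwallBound ‖x₀‖ K ‖F 0‖ T := by
    rw [← hx0]
    refine norm_le_of_linear_growth K.coe_nonneg (norm_nonneg _)
      (fun t ht => (hx t ⟨by linarith [ht.1], ht.2⟩).mono
        (Set.Icc_subset_Icc_left (by linarith))) (fun t _ => hgrow' _)
  have hneg : ∀ t ∈ Set.Icc 0 T, ‖x (-t)‖ ≤ gronwallBound ‖x₀‖ K ‖F 0‖ T := by
    have := norm_le_of_linear_growth (x := fun t => x (-t))
      (x' := fun t => -(F (radialRetract R (x (-t))))) (T := T) K.coe_nonneg (norm_nonneg (F 0))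
      (fun t ht => ?_) (fun t _ => by rw [norm_neg]; exact hgrow' _)
    · simpa [hx0] using this
    · have h1 := hx (-t) ⟨by linarith [ht.2], by linarith [ht.1]⟩
      have h2 := h1.scomp t (hasDerivWithinAt_neg t (Set.Icc 0 T))
        (fun s hs => ⟨by linarith [hs.2], by linarith [hs.1]⟩)
      simpa [Function.comp_def] using h2
  refine ⟨x, hx0, fun t ht => ?_⟩
  have hxt : ‖x t‖ ≤ R := by
    refine le_trans ?_ (le_max_right _ _)
    rcases le_total 0 t with h | h
    · exact hpos t ⟨h, ht.2.le⟩
    · simpa using hneg (-t) ⟨by linarith, by linarith [ht.1]⟩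
  have := (hx t ⟨ht.1.le, ht.2.le⟩).hasDerivAt (Icc_mem_nhds ht.1 ht.2)
  rwa [radialRetract_of_le hR hxt] at this

lemma exists_global_solution [CompleteSpace E] {F : E → E} {K : NNReal} (hF : LipschitzWith K F)
    (x₀ : E) :
    ∃ x : ℝ → E, x 0 = x₀ ∧ ∀ t, HasDerivAt x (F (x t)) t := by
  choose x hx0 hx using fun n : ℕ => exists_solution_Ioo hF x₀ (T := (n : ℝ) + 1) (by positivity)
  have hagree : ∀ m n : ℕ, m ≤ n → ∀ t ∈ Set.Ioo (-((m : ℝ) + 1)) (m + 1), x m t = x n t := by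
    intro m n hmn
    have hmn' : (m : ℝ) ≤ n := by exact_mod_cast hmn
    have hm : (0 : ℝ) ≤ m := by positivity
    exact ODE_solution_unique_of_mem_Ioo (v := fun _ => F) (s := fun _ => Set.univ) (K := K)
      (t₀ := 0) (fun _ _ => hF.lipschitzOnWith) ⟨by linarith, by linarith⟩
      (fun t ht => ⟨hx m t ht, trivial⟩)
      (fun t ht => ⟨hx n t ⟨by linarith [ht.1], by linarith [ht.2]⟩, trivial⟩)
      (by rw [hx0, hx0])
  refine ⟨fun t => x ⌈|t|⌉₊ t, by simp [hx0], fun t => ?_⟩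
  set n := ⌈|t|⌉₊ + 1 with hn
  have hceil : |t| ≤ (⌈|t|⌉₊ : ℝ) := Nat.le_ceil _
  have htn : t ∈ Set.Ioo (-((n : ℝ))) n := by
    rw [hn]; push_cast
    constructor <;> linarith [neg_abs_le t, le_abs_self t]
  have hev : (fun s => x ⌈|s|⌉₊ s) =ᶠ[𝓝 t] x n := by
    filter_upwards [Ioo_mem_nhds htn.1 htn.2] with s hs
    have hs1 : |s| ≤ (⌈|s|⌉₊ : ℝ) := Nat.le_ceil _
    refine hagree _ _ (Nat.ceil_le.2 (abs_le.2 ⟨hs.1.le, hs.2.le⟩)) s ?_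
    constructor <;> linarith [neg_abs_le s, le_abs_self s]
  have hd := hx n t ⟨by linarith [htn.1], by linarith [htn.2]⟩
  have := hd.congr_of_eventuallyEq hev
  rwa [← hev.self_of_nhds] at this

/-- A globally Lipschitz vector field has a globally defined, jointly continuous flow. -/
theorem exists_continuous_flow [CompleteSpace E] {F : E → E} {K : NNReal}
    (hF : LipschitzWith K F) :
    ∃ Φ : E → ℝ → E, (∀ x, Φ x 0 = x) ∧ (∀ x t, HasDerivAt (Φ x) (F (Φ x t)) t) ∧
      Continuous fun z : E × ℝ => Φ z.1 z.2 := by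
  choose Φ h0 hΦ using exists_global_solution hF
  refine ⟨Φ, h0, hΦ, continuous_iff_continuousAt.2 fun ⟨x₀, t₀⟩ => ?_⟩
  rw [ContinuousAt, tendsto_iff_dist_tendsto_zero]
  have hlim : Tendsto (fun z : E × ℝ => dist z.1 x₀ * Real.exp (K * |z.2|)
      + dist (Φ x₀ z.2) (Φ x₀ t₀)) (𝓝 (x₀, t₀)) (𝓝 0) := by
    have hc : Continuous (Φ x₀) :=
      continuous_iff_continuousAt.2 fun t => (hΦ x₀ t).continuousAt
    have : Continuous (fun z : E × ℝ => dist z.1 x₀ * Real.exp (K * |z.2|)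
      + dist (Φ x₀ z.2) (Φ x₀ t₀)) := by fun_prop
    simpa using this.tendsto (x₀, t₀)
  refine squeeze_zero (fun _ => dist_nonneg) (fun z => ?_) hlim
  refine (dist_triangle _ (Φ x₀ z.2) _).trans ?_
  gcongr
  have := dist_le_of_solutions hF (hΦ z.1) (hΦ x₀) z.2
  rwa [h0, h0] at this

end GlobalFlow

section Kernel

/-- The Newtonian kernel `z / ‖z‖³`, softened at distances below `d`. -/
noncomputable def softKernel (d : ℝ) (z : ℂ) : ℂ := ((max d ‖z‖ ^ 3)⁻¹ : ℝ) • z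

lemma softKernel_of_le {d : ℝ} {z : ℂ} (h : d ≤ ‖z‖) :
    softKernel d z = ((‖z‖ ^ 3)⁻¹ : ℝ) • z := by
  rw [softKernel, max_eq_right h]

lemma norm_softKernel_le {d : ℝ} (hd : 0 < d) (z : ℂ) : ‖softKernel d z‖ ≤ (d ^ 2)⁻¹ := by
  set m := max d ‖z‖ with hm_def
  have hm : 0 < m := lt_max_of_lt_left hd
  have hdm : d ≤ m := le_max_left _ _
  have hz : ‖z‖ ≤ m := le_max_right _ _
  rw [softKernel, ← hm_def, norm_smul, Real.norm_of_nonneg (by positivity)]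
  calc (m ^ 3)⁻¹ * ‖z‖ ≤ (m ^ 3)⁻¹ * m := by gcongr
    _ = (m ^ 2)⁻¹ := by field_simp
    _ ≤ (d ^ 2)⁻¹ := by gcongr

lemma lipschitzWith_softKernel {d : ℝ} (hd : 0 < d) :
    LipschitzWith (Real.toNNReal (4 / d ^ 3)) (softKernel d) := by
  refine LipschitzWith.of_dist_le_mul fun x y => ?_
  rw [dist_eq_norm, dist_eq_norm, Real.coe_toNNReal _ (by positivity)]
  set m := max d ‖x‖ with hm_def
  set n := max d ‖y‖ with hn_def
  have hm : 0 < m := lt_max_of_lt_left hd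
  have hn : 0 < n := lt_max_of_lt_left hd
  have hdm : d ≤ m := le_max_left _ _
  have hdn : d ≤ n := le_max_left _ _
  have hsplit : softKernel d x - softKernel d y
      = (m ^ 3)⁻¹ • (x - y)
        + ((n - m) * ((n * m ^ 2)⁻¹ + (n ^ 2 * m)⁻¹ + (m ^ 3)⁻¹)) • ((1 / n) • y) := by
    rw [softKernel, softKernel, ← hm_def, ← hn_def, smul_smul, smul_sub, sub_add, ← sub_smul]
    congr 2
    field_simp
    ring
  have hy : ‖(1 / n) • y‖ ≤ 1 := by
    rw [norm_smul, Real.norm_of_nonneg (by positivity), one_div, inv_mul_le_iff₀ hn, mul_one]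
    exact le_max_right _ _
  have h2 : |n - m| ≤ ‖x - y‖ := abs_max_norm_sub_le d x y
  have e1 : (m ^ 3)⁻¹ ≤ (d ^ 3)⁻¹ := by gcongr
  have e2 : (n * m ^ 2)⁻¹ ≤ (d ^ 3)⁻¹ := by
    rw [show d ^ 3 = d * d ^ 2 by ring]; gcongr
  have e3 : (n ^ 2 * m)⁻¹ ≤ (d ^ 3)⁻¹ := by
    rw [show d ^ 3 = d ^ 2 * d by ring]; gcongr
  have hsum0 : 0 ≤ (n * m ^ 2)⁻¹ + (n ^ 2 * m)⁻¹ + (m ^ 3)⁻¹ := by positivity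
  have hsum : (n * m ^ 2)⁻¹ + (n ^ 2 * m)⁻¹ + (m ^ 3)⁻¹ ≤ 3 * (d ^ 3)⁻¹ := by linarith
  rw [hsplit]
  refine (norm_add_le _ _).trans ?_
  rw [norm_smul, norm_smul _ ((1 / n) • y), Real.norm_of_nonneg (by positivity : 0 ≤ (m ^ 3)⁻¹),
    norm_mul, Real.norm_of_nonneg hsum0, Real.norm_eq_abs]
  have h3 : |n - m| * ((n * m ^ 2)⁻¹ + (n ^ 2 * m)⁻¹ + (m ^ 3)⁻¹) * ‖(1 / n) • y‖
      ≤ ‖x - y‖ * (3 * (d ^ 3)⁻¹) * 1 := by gcongr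
  have h4 : (m ^ 3)⁻¹ * ‖x - y‖ ≤ (d ^ 3)⁻¹ * ‖x - y‖ := by gcongr
  calc _ ≤ (d ^ 3)⁻¹ * ‖x - y‖ + ‖x - y‖ * (3 * (d ^ 3)⁻¹) * 1 := add_le_add h4 h3
    _ = 4 / d ^ 3 * ‖x - y‖ := by ring

end Kernel

section BoundedLipschitz

variable {X : Type*} [PseudoMetricSpace X]

/-- Functions that are both bounded and Lipschitz. -/
def BddLipschitz {Y : Type*} [SeminormedAddCommGroup Y] (f : X → Y) : Prop :=
  (∃ K, LipschitzWith K f) ∧ ∃ C, ∀ x, ‖f x‖ ≤ C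

namespace BddLipschitz

lemma const {Y : Type*} [SeminormedAddCommGroup Y] (c : Y) : BddLipschitz fun _ : X => c :=
  ⟨⟨0, LipschitzWith.const c⟩, ‖c‖, fun _ => le_rfl⟩

lemma add {Y : Type*} [SeminormedAddCommGroup Y] {f g : X → Y} (hf : BddLipschitz f)
    (hg : BddLipschitz g) : BddLipschitz fun x => f x + g x := by
  obtain ⟨⟨K, hK⟩, C, hC⟩ := hf
  obtain ⟨⟨K', hK'⟩, C', hC'⟩ := hg
  exact ⟨⟨_, hK.add hK'⟩, C + C', fun x => (norm_add_le _ _).trans (add_le_add (hC x) (hC' x))⟩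

lemma neg {Y : Type*} [SeminormedAddCommGroup Y] {f : X → Y} (hf : BddLipschitz f) :
    BddLipschitz fun x => -f x := by
  obtain ⟨⟨K, hK⟩, C, hC⟩ := hf
  exact ⟨⟨_, hK.neg⟩, C, fun x => by rw [norm_neg]; exact hC x⟩

lemma sub {Y : Type*} [SeminormedAddCommGroup Y] {f g : X → Y} (hf : BddLipschitz f)
    (hg : BddLipschitz g) : BddLipschitz fun x => f x - g x := by
  simpa only [sub_eq_add_neg] using hf.add hg.neg

lemma mul {Y : Type*} [SeminormedRing Y] {f g : X → Y} (hf : BddLipschitz f)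
    (hg : BddLipschitz g) : BddLipschitz fun x => f x * g x := by
  obtain ⟨⟨K, hK⟩, C, hC⟩ := hf
  obtain ⟨⟨K', hK'⟩, C', hC'⟩ := hg
  refine ⟨⟨K * Real.toNNReal C' + Real.toNNReal C * K',
    LipschitzWith.of_dist_le_mul fun x y => ?_⟩, Real.toNNReal C * C', fun x => ?_⟩
  · have hx : ‖f y‖ ≤ Real.toNNReal C := (hC y).trans (Real.le_coe_toNNReal C)
    have hy : ‖g x‖ ≤ Real.toNNReal C' := (hC' x).trans (Real.le_coe_toNNReal C')
    have h1 := hK.dist_le_mul x y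
    have h2 := hK'.dist_le_mul x y
    rw [dist_eq_norm] at h1 h2
    rw [dist_eq_norm, show f x * g x - f y * g y = (f x - f y) * g x + f y * (g x - g y) by
      noncomm_ring]
    calc _ ≤ ‖f x - f y‖ * ‖g x‖ + ‖f y‖ * ‖g x - g y‖ :=
          (norm_add_le _ _).trans (add_le_add (norm_mul_le _ _) (norm_mul_le _ _))
      _ ≤ (K * dist x y) * Real.toNNReal C' + Real.toNNReal C * (K' * dist x y) := by gcongr
      _ = _ := by push_cast; ring
  · refine (norm_mul_le _ _).trans ?_
    have hx : ‖f x‖ ≤ Real.toNNReal C := (hC x).trans (Real.le_coe_toNNReal C)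
    exact mul_le_mul hx (hC' x) (norm_nonneg _) (by positivity)

/-- Post-composition with a Lipschitz map that has norm bounded on the range. -/
lemma of_bound {Y Z : Type*} [SeminormedAddCommGroup Y] [SeminormedAddCommGroup Z] {φ : Y → Z}
    {K : NNReal} (hφ : LipschitzWith K φ) {f : X → Y} (hf : BddLipschitz f) :
    BddLipschitz fun x => φ (f x) := by
  obtain ⟨⟨K', hK'⟩, C, hC⟩ := hf
  refine ⟨⟨_, hφ.comp hK'⟩, K * C + ‖φ 0‖, fun x => ?_⟩
  have h1 := hφ.dist_le_mul (f x) 0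
  rw [dist_eq_norm, dist_zero_right] at h1
  have h2 : (K : ℝ) * ‖f x‖ ≤ K * C := by gcongr; exact hC x
  linarith [norm_le_norm_add_norm_sub' (φ (f x)) (φ 0)]

lemma star_comp {f : X → ℂ} (hf : BddLipschitz f) :
    BddLipschitz fun x => (starRingEnd ℂ) (f x) :=
  of_bound (φ := fun z : ℂ => (starRingEnd ℂ) z) (K := 1)
    (Complex.isometry_conj.lipschitz) hf

lemma re {f : X → ℂ} (hf : BddLipschitz f) : BddLipschitz fun x => (f x).re :=
  of_bound (φ := Complex.re) (K := ‖Complex.reCLM‖₊) Complex.reCLM.lipschitz hf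

lemma ofReal {f : X → ℝ} (hf : BddLipschitz f) : BddLipschitz fun x => (f x : ℂ) :=
  of_bound (φ := fun a : ℝ => (a : ℂ)) (K := 1) Complex.isometry_ofReal.lipschitz hf

lemma prodMk {Y Z : Type*} [SeminormedAddCommGroup Y] [SeminormedAddCommGroup Z] {f : X → Y}
    {g : X → Z} (hf : BddLipschitz f) (hg : BddLipschitz g) :
    BddLipschitz fun x => (f x, g x) := by
  obtain ⟨⟨K, hK⟩, C, hC⟩ := hf
  obtain ⟨⟨K', hK'⟩, C', hC'⟩ := hg
  refine ⟨⟨_, hK.prodMk hK'⟩, max C C', fun x => ?_⟩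
  rw [Prod.norm_def]
  exact max_le_max (hC x) (hC' x)

lemma radialRetract_comp {Y : Type*} [NormedAddCommGroup Y] [NormedSpace ℝ Y] {R : ℝ}
    (hR : 0 < R) {f : X → Y} {K : NNReal} (hf : LipschitzWith K f) :
    BddLipschitz fun x => radialRetract R (f x) :=
  ⟨⟨_, (lipschitzWith_radialRetract hR).comp hf⟩, R, fun _ => norm_radialRetract_le hR _⟩

lemma exp_mul_I {f : X → ℝ} {K : NNReal} (hf : LipschitzWith K f) :
    BddLipschitz fun x => Complex.exp (f x * Complex.I) := by
  have h : LipschitzWith 1 fun s : ℝ => Complex.exp (s * Complex.I) := by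
    have hd : ∀ s : ℝ, HasDerivAt (fun s : ℝ => Complex.exp (s * Complex.I))
        (Complex.exp (s * Complex.I) * Complex.I) s := fun s => by
      simpa using ((Complex.ofRealCLM.hasDerivAt (x := s)).mul_const Complex.I).cexp
    refine lipschitzWith_of_nnnorm_deriv_le (fun s => (hd s).differentiableAt) fun s => ?_
    rw [(hd s).deriv, ← NNReal.coe_le_coe, coe_nnnorm, norm_mul,
      Complex.norm_exp_ofReal_mul_I]
    simp
  exact ⟨⟨_, h.comp hf⟩, 1, fun x => (Complex.norm_exp_ofReal_mul_I _).le⟩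

end BddLipschitz

end BoundedLipschitz

section Conversion

lemma nrm2_eq_norm (z : ℂ) : nrm2 z.re z.im = ‖z‖ := by
  rw [nrm2, Complex.norm_eq_sqrt_sq_add_sq]

lemma dS_eq_norm (μ : ℝ) (z : ℂ) : dS μ z.re z.im = ‖z + μ‖ := by
  rw [dS, Complex.norm_eq_sqrt_sq_add_sq]; simp

lemma dJ_eq_norm (μ : ℝ) (z : ℂ) : dJ μ z.re z.im = ‖z - (1 - μ)‖ := by
  rw [dJ, Complex.norm_eq_sqrt_sq_add_sq]; simp

lemma HasDerivAt.complex_re {f : ℝ → ℂ} {f' : ℂ} {t : ℝ} (h : HasDerivAt f f' t) :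
    HasDerivAt (fun s => (f s).re) f'.re t :=
  (Complex.reCLM.hasFDerivAt (x := f t)).comp_hasDerivAt t h

lemma HasDerivAt.complex_im {f : ℝ → ℂ} {f' : ℂ} {t : ℝ} (h : HasDerivAt f f' t) :
    HasDerivAt (fun s => (f s).im) f'.im t :=
  (Complex.imCLM.hasFDerivAt (x := f t)).comp_hasDerivAt t h

/-- Rate of change of the momentum in complex notation. -/
noncomputable def momentumField (μ : ℝ) (q p : ℂ) : ℂ :=
  -Complex.I * p - (1 - μ) * (((‖q + μ‖ ^ 3)⁻¹ : ℝ) • (q + μ))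
    - μ * (((‖q - (1 - μ)‖ ^ 3)⁻¹ : ℝ) • (q - (1 - μ)))

/-- A complex curve, given by position and momentum, solves the equations of motion at a time. -/
structure SolvesAt (μ : ℝ) (Q : ℝ → ℂ × ℂ) (t : ℝ) : Prop where
  add_ne : (Q t).1 + μ ≠ 0
  sub_ne : (Q t).1 - (1 - μ) ≠ 0
  position : HasDerivAt (fun s => (Q s).1) ((Q t).2 - Complex.I * (Q t).1) t
  momentum : HasDerivAt (fun s => (Q s).2) (momentumField μ (Q t).1 (Q t).2) t

lemma SolvesAt.isPCRTBPSol {μ : ℝ} {Q : ℝ → ℂ × ℂ} {I : Set ℝ} (hQ : ∀ t ∈ I, SolvesAt μ Q t) :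
    IsPCRTBPSol μ I (fun t => (Q t).1.re) (fun t => (Q t).1.im) (fun t => (Q t).2.re)
      (fun t => (Q t).2.im) := by
  intro t ht
  refine ⟨⟨fun h => (hQ t ht).add_ne ?_, fun h => (hQ t ht).sub_ne ?_⟩, ?_, ?_, ?_, ?_⟩
  · simp only [Prod.mk.injEq] at h
    apply Complex.ext <;> simp [h.1, h.2]
  · simp only [Prod.mk.injEq] at h
    apply Complex.ext <;> simp [h.1, h.2]
  · simpa using (hQ t ht).position.complex_re
  · simpa using (hQ t ht).position.complex_im
  · convert (hQ t ht).momentum.complex_re using 1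
    rw [dS_eq_norm, dJ_eq_norm, momentumField, div_eq_mul_inv, div_eq_mul_inv]
    generalize (‖(Q t).1 + μ‖ ^ 3)⁻¹ = a
    generalize (‖(Q t).1 - (1 - μ)‖ ^ 3)⁻¹ = b
    simp
    ring
  · convert (hQ t ht).momentum.complex_im using 1
    rw [dS_eq_norm, dJ_eq_norm, momentumField, div_eq_mul_inv, div_eq_mul_inv]
    generalize (‖(Q t).1 + μ‖ ^ 3)⁻¹ = a
    generalize (‖(Q t).1 - (1 - μ)‖ ^ 3)⁻¹ = b
    simp
    ring

end Conversion

section Conservation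

variable {μ : ℝ} {q1 q2 p1 p2 : ℝ → ℝ}

lemma IsPCRTBPSol.mono {I I' : Set ℝ} (h : IsPCRTBPSol μ I q1 q2 p1 p2) (hI : I' ⊆ I) :
    IsPCRTBPSol μ I' q1 q2 p1 p2 := fun t ht => h t (hI ht)

lemma sq_add_sq_pos_of_ne {x y a b : ℝ} (h : (x, y) ≠ (a, b)) : 0 < (x - a) ^ 2 + (y - b) ^ 2 := by
  by_contra hc
  apply h
  have h1 : x - a = 0 := by nlinarith [sq_nonneg (x - a), sq_nonneg (y - b)]
  have h2 : y - b = 0 := by nlinarith [sq_nonneg (x - a), sq_nonneg (y - b)]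
  rw [sub_eq_zero.1 h1, sub_eq_zero.1 h2]

lemma dS_pos {x y : ℝ} (h : (x, y) ≠ (-μ, 0)) : 0 < dS μ x y :=
  Real.sqrt_pos.2 (by simpa using sq_add_sq_pos_of_ne h)

lemma dJ_pos {x y : ℝ} (h : (x, y) ≠ (1 - μ, 0)) : 0 < dJ μ x y :=
  Real.sqrt_pos.2 (by simpa using sq_add_sq_pos_of_ne h)

lemma dS_sq (x y : ℝ) : dS μ x y ^ 2 = (x + μ) ^ 2 + y ^ 2 := Real.sq_sqrt (by positivity)

lemma dJ_sq (x y : ℝ) : dJ μ x y ^ 2 = (x - (1 - μ)) ^ 2 + y ^ 2 := Real.sq_sqrt (by positivity)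

lemma nrm2_sq (x y : ℝ) : nrm2 x y ^ 2 = x ^ 2 + y ^ 2 := Real.sq_sqrt (by positivity)

lemma hasDerivAt_sqrt_sq_add_sq {f g : ℝ → ℝ} {f' g' t : ℝ} (hf : HasDerivAt f f' t)
    (hg : HasDerivAt g g' t) (h : 0 < f t ^ 2 + g t ^ 2) :
    HasDerivAt (fun s => √(f s ^ 2 + g s ^ 2))
      ((f t * f' + g t * g') / √(f t ^ 2 + g t ^ 2)) t := by
  have := ((hf.fun_pow 2).fun_add (hg.fun_pow 2)).sqrt h.ne'
  convert this using 1
  have : 0 < √(f t ^ 2 + g t ^ 2) := Real.sqrt_pos.2 h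
  field_simp
  norm_num
  ring

lemma IsPCRTBPSol.hasDerivAt_ham {I : Set ℝ} (h : IsPCRTBPSol μ I q1 q2 p1 p2) {t : ℝ}
    (ht : t ∈ I) : HasDerivAt (fun s => Ham μ (q1 s) (q2 s) (p1 s) (p2 s)) 0 t := by
  obtain ⟨⟨hS, hJ⟩, h1, h2, h3, h4⟩ := h t ht
  have hSpos := dS_pos hS
  have hJpos := dJ_pos hJ
  have hdS : HasDerivAt (fun s => dS μ (q1 s) (q2 s)) _ t :=
    hasDerivAt_sqrt_sq_add_sq (h1.add_const μ) h2 (Real.sqrt_pos.1 hSpos)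
  have hdJ : HasDerivAt (fun s => dJ μ (q1 s) (q2 s)) _ t :=
    hasDerivAt_sqrt_sq_add_sq (h1.sub_const (1 - μ)) h2 (Real.sqrt_pos.1 hJpos)
  have key := ((((((h3.fun_pow 2).fun_add (h4.fun_pow 2)).div_const 2).fun_sub
    (h1.fun_mul h4)).fun_add
    (h2.fun_mul h3)).fun_sub ((hasDerivAt_const t (1 - μ)).fun_div hdS hSpos.ne')).fun_sub
      ((hasDerivAt_const t μ).fun_div hdJ hJpos.ne')
  refine (key.congr_deriv ?_ : _)
  rw [show √((q1 t + μ) ^ 2 + q2 t ^ 2) = dS μ (q1 t) (q2 t) from rfl,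
    show √((q1 t - (1 - μ)) ^ 2 + q2 t ^ 2) = dJ μ (q1 t) (q2 t) from rfl]
  field_simp
  norm_num
  ring

lemma IsPCRTBPSol.ham_eq {a b : ℝ} (h : IsPCRTBPSol μ (Set.Icc a b) q1 q2 p1 p2) {t : ℝ}
    (ht : t ∈ Set.Icc a b) :
    Ham μ (q1 t) (q2 t) (p1 t) (p2 t) = Ham μ (q1 a) (q2 a) (p1 a) (p2 a) :=
  constant_of_has_deriv_right_zero
    (fun _ hs => (h.hasDerivAt_ham hs).continuousAt.continuousWithinAt)
    (fun _ hs => (h.hasDerivAt_ham ⟨hs.1, hs.2.le⟩).hasDerivWithinAt) t ht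

end Conservation

section RadialMotion

variable {μ : ℝ} {q1 q2 p1 p2 : ℝ → ℝ}

/-- Radial component of the gravitational force, multiplied by the distance to the origin. -/
noncomputable def virial (μ x y : ℝ) : ℝ :=
  -(1 - μ) * (x * (x + μ) + y ^ 2) / dS μ x y ^ 3
    - μ * (x * (x - (1 - μ)) + y ^ 2) / dJ μ x y ^ 3

/-- Torque of the gravitational force about the origin. -/
noncomputable def torque (μ x y : ℝ) : ℝ :=
  (1 - μ) * μ * y / dS μ x y ^ 3 - μ * (1 - μ) * y / dJ μ x y ^ 3

lemma IsPCRTBPSol.hasDerivAt_nrm2 {I : Set ℝ} (h : IsPCRTBPSol μ I q1 q2 p1 p2) {t : ℝ}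
    (ht : t ∈ I) (hr : 0 < nrm2 (q1 t) (q2 t)) :
    HasDerivAt (fun s => nrm2 (q1 s) (q2 s))
      ((q1 t * p1 t + q2 t * p2 t) / nrm2 (q1 t) (q2 t)) t := by
  obtain ⟨-, h1, h2, -, -⟩ := h t ht
  refine (hasDerivAt_sqrt_sq_add_sq h1 h2 (Real.sqrt_pos.1 hr)).congr_deriv ?_
  rw [nrm2]
  ring

lemma IsPCRTBPSol.hasDerivAt_radialVelocity {I : Set ℝ} (h : IsPCRTBPSol μ I q1 q2 p1 p2) {t : ℝ}
    (ht : t ∈ I) (hr : 0 < nrm2 (q1 t) (q2 t)) :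
    HasDerivAt (fun s => (q1 s * p1 s + q2 s * p2 s) / nrm2 (q1 s) (q2 s))
      (virial μ (q1 t) (q2 t) / nrm2 (q1 t) (q2 t)
        + (q1 t * p2 t - q2 t * p1 t) ^ 2 / nrm2 (q1 t) (q2 t) ^ 3) t := by
  obtain ⟨⟨hS, hJ⟩, h1, h2, h3, h4⟩ := h t ht
  have hSpos := dS_pos hS
  have hJpos := dJ_pos hJ
  have key := ((h1.fun_mul h3).fun_add (h2.fun_mul h4)).fun_div (h.hasDerivAt_nrm2 ht hr) hr.ne'
  refine key.congr_deriv ?_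
  rw [virial]
  have hsq := nrm2_sq (q1 t) (q2 t)
  generalize dS μ (q1 t) (q2 t) = S at *
  generalize dJ μ (q1 t) (q2 t) = J at *
  generalize nrm2 (q1 t) (q2 t) = r at *
  have e : (q1 t * p2 t - q2 t * p1 t) ^ 2
      = r ^ 2 * (p1 t ^ 2 + p2 t ^ 2) - (q1 t * p1 t + q2 t * p2 t) ^ 2 := by rw [hsq]; ring
  rw [e]
  field_simp
  ring

lemma IsPCRTBPSol.hasDerivAt_angularMomentum {I : Set ℝ} (h : IsPCRTBPSol μ I q1 q2 p1 p2)
    {t : ℝ} (ht : t ∈ I) :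
    HasDerivAt (fun s => q1 s * p2 s - q2 s * p1 s) (torque μ (q1 t) (q2 t)) t := by
  obtain ⟨-, h1, h2, h3, h4⟩ := h t ht
  refine ((h1.fun_mul h4).fun_sub (h2.fun_mul h3)).congr_deriv ?_
  rw [torque]
  ring

end RadialMotion

section FarBounds

variable {μ x y : ℝ}

lemma abs_fst_le_nrm2 (x y : ℝ) : |x| ≤ nrm2 x y := Real.abs_le_sqrt (by nlinarith [sq_nonneg y])

lemma abs_snd_le_nrm2 (x y : ℝ) : |y| ≤ nrm2 x y := Real.abs_le_sqrt (by nlinarith [sq_nonneg x])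

lemma dS_far_bounds (hμ : 0 < μ) (hμ' : μ < 1 / 100) (hr : 4 ≤ nrm2 x y) :
    99 / 100 * nrm2 x y ≤ dS μ x y ∧ dS μ x y ≤ 101 / 100 * nrm2 x y := by
  have hx := abs_le.1 (abs_fst_le_nrm2 x y)
  have hsq := nrm2_sq x y
  have hd := dS_sq (μ := μ) x y
  have hd0 : 0 ≤ dS μ x y := Real.sqrt_nonneg _
  constructor
  · refine le_of_sq_le_sq ?_ hd0 |>.trans le_rfl
    rw [hd]; nlinarith
  · refine le_of_sq_le_sq ?_ (by linarith)
    rw [hd]; nlinarith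

lemma dJ_far_bound (hμ : 0 < μ) (hμ' : μ < 1 / 100) (hr : 4 ≤ nrm2 x y) :
    nrm2 x y - 1 ≤ dJ μ x y := by
  have hx := abs_le.1 (abs_fst_le_nrm2 x y)
  have hsq := nrm2_sq x y
  have hd := dJ_sq (μ := μ) x y
  have hd0 : 0 ≤ dJ μ x y := Real.sqrt_nonneg _
  refine le_of_sq_le_sq ?_ hd0
  rw [hd]; nlinarith

lemma div_cube_le {a r s : ℝ} {k : ℝ} (hk : 0 < k) (hr : 0 < r) (hs : k * r ≤ s) (ha : 0 ≤ a) :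
    a / s ^ 3 ≤ a / (k ^ 3 * r ^ 3) := by
  rw [← mul_pow]
  gcongr

lemma le_div_cube {a r s : ℝ} {k : ℝ} (hs0 : 0 < s) (hs : s ≤ k * r) (ha : 0 ≤ a) :
    a / (k ^ 3 * r ^ 3) ≤ a / s ^ 3 := by
  rw [← mul_pow]
  gcongr

lemma virial_bounds (hμ : 0 < μ) (hμ' : μ < 1 / 100) (hr : 4 ≤ nrm2 x y) :
    -2 / nrm2 x y ≤ virial μ x y ∧ virial μ x y ≤ -(3 / 4) / nrm2 x y := by
  obtain ⟨hS1, hS2⟩ := dS_far_bounds hμ hμ' hr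
  have hJ := dJ_far_bound hμ hμ' hr
  have hx := abs_le.1 (abs_fst_le_nrm2 x y)
  have hsq := nrm2_sq x y
  rw [virial]
  generalize dS μ x y = S at *
  generalize dJ μ x y = J at *
  generalize nrm2 x y = r at *
  have hr0 : 0 < r := by linarith
  have hJ' : 3 / 4 * r ≤ J := by linarith
  have hS0 : 0 < S := by linarith
  have e1 : -(1 - μ) * (x * (x + μ) + y ^ 2) / S ^ 3
      = -(((1 - μ) * (r ^ 2 + μ * x)) / S ^ 3) := by rw [hsq]; ring
  have e2 : μ * (x * (x - (1 - μ)) + y ^ 2) / J ^ 3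
      = (μ * (r ^ 2 - (1 - μ) * x)) / J ^ 3 := by rw [hsq]; ring
  rw [e1, e2]
  have b1 : 99 / 100 * r ^ 2 ≤ r ^ 2 + μ * x := by nlinarith
  have b2 : r ^ 2 + μ * x ≤ 101 / 100 * r ^ 2 := by nlinarith
  have b3 : 0 ≤ r ^ 2 - (1 - μ) * x := by nlinarith
  have b4 : r ^ 2 - (1 - μ) * x ≤ 2 * r ^ 2 := by nlinarith
  have c1 : 98 / 100 * r ^ 2 ≤ (1 - μ) * (r ^ 2 + μ * x) := by nlinarith
  have c2 : (1 - μ) * (r ^ 2 + μ * x) ≤ 102 / 100 * r ^ 2 := by nlinarith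
  have c3 : 0 ≤ μ * (r ^ 2 - (1 - μ) * x) := by positivity
  have c4 : μ * (r ^ 2 - (1 - μ) * x) ≤ 2 / 100 * r ^ 2 := by nlinarith
  have d1 := div_cube_le (by norm_num) hr0 hS1 (by nlinarith : 0 ≤ (1 - μ) * (r ^ 2 + μ * x))
  have d2 := le_div_cube hS0 hS2 (by nlinarith : 0 ≤ (1 - μ) * (r ^ 2 + μ * x))
  have d3 := div_cube_le (by norm_num) hr0 hJ' c3
  have d4 : 0 ≤ (μ * (r ^ 2 - (1 - μ) * x)) / J ^ 3 := by
    have : 0 < J := by linarith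
    positivity
  constructor
  · have f1 : (1 - μ) * (r ^ 2 + μ * x) / ((99 / 100) ^ 3 * r ^ 3) ≤ (11 / 10) / r := by
      rw [div_le_div_iff₀ (by positivity) hr0]
      nlinarith
    have f2 : μ * (r ^ 2 - (1 - μ) * x) / ((3 / 4) ^ 3 * r ^ 3) ≤ (1 / 10) / r := by
      rw [div_le_div_iff₀ (by positivity) hr0]
      nlinarith
    have f3 : -2 / r = -(11 / 10) / r - (1 / 10) / r - (8 / 10) / r := by ring
    have f4 : 0 < (8 / 10) / r := by positivity
    have f5 : -(11 / 10) / r = -((11 / 10) / r) := by ring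
    linarith
  · have f1 : (3 / 4) / r ≤ (1 - μ) * (r ^ 2 + μ * x) / ((101 / 100) ^ 3 * r ^ 3) := by
      rw [div_le_div_iff₀ hr0 (by positivity)]
      nlinarith
    have f5 : -(3 / 4) / r = -((3 / 4) / r) := by ring
    linarith

lemma radialForce_bounds (hμ : 0 < μ) (hμ' : μ < 1 / 100) (hr : 4 ≤ nrm2 x y) {G : ℝ}
    (hG : |G| ≤ 1) :
    -2 / nrm2 x y ^ 2 ≤ virial μ x y / nrm2 x y + G ^ 2 / nrm2 x y ^ 3 ∧
      virial μ x y / nrm2 x y + G ^ 2 / nrm2 x y ^ 3 ≤ -(1 / 2) / nrm2 x y ^ 2 := by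
  obtain ⟨h1, h2⟩ := virial_bounds hμ hμ' hr
  generalize nrm2 x y = r at *
  generalize virial μ x y = V at *
  have hr0 : 0 < r := by linarith
  have hG2 : G ^ 2 ≤ 1 := by rw [← sq_abs]; nlinarith [abs_nonneg G]
  rw [div_le_iff₀ hr0] at h1
  rw [le_div_iff₀ hr0] at h2
  have e : V / r + G ^ 2 / r ^ 3 = (V * r + G ^ 2 / r) / r ^ 2 := by field_simp
  rw [e]
  have g1 : 0 ≤ G ^ 2 / r := by positivity
  have g2 : G ^ 2 / r ≤ 1 / 4 := by rw [div_le_iff₀ hr0]; linarith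
  constructor <;> gcongr <;> linarith

lemma abs_torque_le (hμ : 0 < μ) (hμ' : μ < 1 / 100) (hr : 4 ≤ nrm2 x y) :
    |torque μ x y| ≤ 5 * μ / nrm2 x y ^ 2 := by
  obtain ⟨hS1, -⟩ := dS_far_bounds hμ hμ' hr
  have hJ := dJ_far_bound hμ hμ' hr
  have hy := abs_snd_le_nrm2 x y
  rw [torque]
  generalize dS μ x y = S at *
  generalize dJ μ x y = J at *
  generalize nrm2 x y = r at *
  have hr0 : 0 < r := by linarith
  have hJ' : 3 / 4 * r ≤ J := by linarith
  have hS' : 3 / 4 * r ≤ S := by linarith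
  have hS0 : 0 < S := by linarith
  have hJ0 : 0 < J := by linarith
  have hμ1 : 0 < 1 - μ := by linarith
  have k1 : |(1 - μ) * μ * y| ≤ μ * r := by
    rw [abs_mul, abs_of_pos (mul_pos hμ1 hμ)]
    nlinarith [abs_nonneg y, mul_le_mul_of_nonneg_left hy hμ.le, mul_nonneg hμ.le (abs_nonneg y)]
  have key : ∀ s, 3 / 4 * r ≤ s → |(1 - μ) * μ * y / s ^ 3| ≤ (5 / 2) * μ / r ^ 2 := by
    intro s hs
    have hs0 : 0 < s := by linarith
    rw [abs_div, abs_of_pos (pow_pos hs0 3)]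
    refine (div_cube_le (by norm_num) hr0 hs (abs_nonneg _)).trans ?_
    rw [div_le_div_iff₀ (by positivity) (by positivity)]
    have := mul_le_mul_of_nonneg_right k1 (sq_nonneg r)
    nlinarith [mul_pos hμ (pow_pos hr0 3)]
  have e : μ * (1 - μ) * y = (1 - μ) * μ * y := by ring
  rw [e]
  refine (abs_sub _ _).trans ((add_le_add (key S hS') (key J hJ')).trans (le_of_eq ?_))
  ring

/-- The gravitational potential (with positive sign). -/
noncomputable def potential (μ x y : ℝ) : ℝ := (1 - μ) / dS μ x y + μ / dJ μ x y

lemma potential_bounds (hμ : 0 < μ) (hμ' : μ < 1 / 100) (hr : 4 ≤ nrm2 x y) :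
    1 / (2 * nrm2 x y ^ 2) ≤ potential μ x y ∧ potential μ x y ≤ 2 / nrm2 x y := by
  obtain ⟨hS1, hS2⟩ := dS_far_bounds hμ hμ' hr
  have hJ := dJ_far_bound hμ hμ' hr
  rw [potential]
  generalize dS μ x y = S at *
  generalize dJ μ x y = J at *
  generalize nrm2 x y = r at *
  have hr0 : 0 < r := by linarith
  have hJ' : 3 / 4 * r ≤ J := by linarith
  have hS0 : 0 < S := by linarith
  have hJ0 : 0 < J := by linarith
  have hμJ : 0 ≤ μ / J := by positivity
  constructor
  · refine le_add_of_le_of_nonneg ?_ hμJ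
    rw [div_le_div_iff₀ (by positivity) hS0]
    nlinarith
  · have h1 : (1 - μ) / S ≤ (3 / 2) / r := by
      rw [div_le_div_iff₀ hS0 hr0]; nlinarith
    have h2 : μ / J ≤ (1 / 2) / r := by
      rw [div_le_div_iff₀ hJ0 hr0]; nlinarith
    refine (add_le_add h1 h2).trans (le_of_eq ?_)
    ring

/-- The Hamiltonian in polar variables. -/
lemma ham_eq_polar (p1 p2 : ℝ) (hr : 0 < nrm2 x y) :
    Ham μ x y p1 p2 = ((x * p1 + y * p2) / nrm2 x y) ^ 2 / 2
      + (x * p2 - y * p1) ^ 2 / (2 * nrm2 x y ^ 2) - (x * p2 - y * p1) - potential μ x y := by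
  have hsq := nrm2_sq x y
  have hne : x ^ 2 + y ^ 2 ≠ 0 := by rw [← hsq]; positivity
  rw [Ham, potential, div_pow, hsq]
  have : (p1 ^ 2 + p2 ^ 2) / 2 = (x * p1 + y * p2) ^ 2 / (x ^ 2 + y ^ 2) / 2
      + (x * p2 - y * p1) ^ 2 / (2 * (x ^ 2 + y ^ 2)) := by
    field_simp
    ring
  rw [this]
  ring

end FarBounds

section RadialSystem

/-- Scalar description of a motion at distance `r` from the centre, with `N` half the rate of change
of `r ^ 2`, radial velocity `ρ`, angular momentum `G` and potential `U`, valid while `4 ≤ r`. -/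
structure RadialSystem (μ h : ℝ) (r N ρ G U : ℝ → ℝ) : Prop where
  nonneg : ∀ t, 0 ≤ r t
  continuous_N : Continuous N
  hasDerivAt_sq : ∀ t, HasDerivAt (fun s => r s ^ 2) (2 * N t) t
  N_eq : ∀ t, 4 ≤ r t → N t = r t * ρ t
  hasDerivAt_r : ∀ t, 4 ≤ r t → HasDerivAt r (ρ t) t
  hasDerivAt_ρ : ∀ t, 4 ≤ r t → ∃ f, HasDerivAt ρ f t ∧
    (|G t| ≤ 1 → -2 / r t ^ 2 ≤ f ∧ f ≤ -(1 / 2) / r t ^ 2)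
  hasDerivAt_G : ∀ t, 4 ≤ r t → ∃ f, HasDerivAt G f t ∧ |f| ≤ 5 * μ / r t ^ 2
  hasDerivAt_energy : ∀ t, 4 ≤ r t →
    HasDerivAt (fun s => ρ s ^ 2 / 2 + G s ^ 2 / (2 * r s ^ 2) - G s - U s) 0 t
  U_bounds : ∀ t, 4 ≤ r t → 1 / (2 * r t ^ 2) ≤ U t ∧ U t ≤ 2 / r t
  r_zero : 4 ≤ r 0
  ρ_zero : ρ 0 ≤ 1
  N_zero : 0 < N 0
  G_zero : |G 0| < 1 / 2
  energy_zero : ρ 0 ^ 2 / 2 + G 0 ^ 2 / (2 * r 0 ^ 2) - G 0 - U 0 = h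
  abs_h : |h| ≤ 1 / 10
  μ_pos : 0 < μ

namespace RadialSystem

variable {μ h : ℝ} {r N ρ G U : ℝ → ℝ}

lemma monotoneOn_r (S : RadialSystem μ h r N ρ G U) {T : ℝ} (hN : ∀ t ∈ Set.Icc 0 T, 0 ≤ N t) :
    MonotoneOn r (Set.Icc 0 T) := by
  have hsq : MonotoneOn (fun s => r s ^ 2) (Set.Icc 0 T) := by
    refine monotoneOn_of_hasDerivWithinAt_nonneg (f' := fun t => 2 * N t) (convex_Icc 0 T)
      (fun t _ => (S.hasDerivAt_sq t).continuousAt.continuousWithinAt)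
      (fun t _ => (S.hasDerivAt_sq t).hasDerivWithinAt) (fun t ht => ?_)
    have := hN t (interior_subset ht)
    positivity
  intro a ha b hb hab
  exact le_of_sq_le_sq (hsq ha hb hab) (S.nonneg b)

lemma four_le (S : RadialSystem μ h r N ρ G U) {T : ℝ} (hN : ∀ t ∈ Set.Icc 0 T, 0 ≤ N t) {t : ℝ}
    (ht : t ∈ Set.Icc 0 T) : 4 ≤ r t :=
  S.r_zero.trans (S.monotoneOn_r hN ⟨le_rfl, ht.1.trans ht.2⟩ ht ht.1)

lemma ρ_nonneg (S : RadialSystem μ h r N ρ G U) {T : ℝ} (hN : ∀ t ∈ Set.Icc 0 T, 0 ≤ N t) {t : ℝ}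
    (ht : t ∈ Set.Icc 0 T) : 0 ≤ ρ t := by
  have h4 := S.four_le hN ht
  have h1 := hN t ht
  rw [S.N_eq t h4] at h1
  exact nonneg_of_mul_nonneg_right h1 (by linarith)

lemma energy_eq (S : RadialSystem μ h r N ρ G U) {T : ℝ} (hN : ∀ t ∈ Set.Icc 0 T, 0 ≤ N t) {t : ℝ}
    (ht : t ∈ Set.Icc 0 T) : ρ t ^ 2 / 2 + G t ^ 2 / (2 * r t ^ 2) - G t - U t = h := by
  rw [← S.energy_zero]
  exact constant_of_has_deriv_right_zero
    (fun s hs => (S.hasDerivAt_energy s (S.four_le hN hs)).continuousAt.continuousWithinAt)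
    (fun s hs => (S.hasDerivAt_energy s
      (S.four_le hN ⟨hs.1, hs.2.le⟩)).hasDerivWithinAt) t ht

lemma strictAntiOn_ρ_aux (S : RadialSystem μ h r N ρ G U) {T : ℝ}
    (hN : ∀ t ∈ Set.Icc 0 T, 0 ≤ N t) (hG : ∀ t ∈ Set.Ico 0 T, |G t| ≤ 1) :
    StrictAntiOn ρ (Set.Icc 0 T) := by
  refine strictAntiOn_of_deriv_neg (convex_Icc 0 T) (fun t ht => ?_) (fun t ht => ?_)
  · obtain ⟨f, hf, -⟩ := S.hasDerivAt_ρ t (S.four_le hN ht)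
    exact hf.continuousAt.continuousWithinAt
  · rw [interior_Icc] at ht
    have h4 := S.four_le hN ⟨ht.1.le, ht.2.le⟩
    obtain ⟨f, hf, hb⟩ := S.hasDerivAt_ρ t h4
    rw [hf.deriv]
    refine (hb (hG t ⟨ht.1.le, ht.2⟩)).2.trans_lt (div_neg_of_neg_of_pos (by norm_num) ?_)
    have : 0 < r t := by linarith
    positivity

lemma continuousOn_G (S : RadialSystem μ h r N ρ G U) {T : ℝ} (hN : ∀ t ∈ Set.Icc 0 T, 0 ≤ N t) :
    ContinuousOn G (Set.Icc 0 T) := fun t ht => by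
  obtain ⟨f, hf, -⟩ := S.hasDerivAt_G t (S.four_le hN ht)
  exact hf.continuousAt.continuousWithinAt

/-- While the motion is outgoing, the angular momentum stays bounded by one. -/
lemma abs_G_lt (S : RadialSystem μ h r N ρ G U) {T : ℝ} (hN : ∀ t ∈ Set.Icc 0 T, 0 ≤ N t) {t : ℝ}
    (ht : t ∈ Set.Icc 0 T) : |G t| < 1 := by
  by_contra! hc
  have hcont : ContinuousOn (fun s => |G s|) (Set.Icc 0 T) := (S.continuousOn_G hN).abs
  have hG0 : |G 0| ≤ 1 := by linarith [S.G_zero]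
  have hcross : ∀ b ∈ Set.Icc 0 T, 1 ≤ |G b| → ∃ s ∈ Set.Icc 0 b, |G s| = 1 := by
    intro b hb hb1
    obtain ⟨s, hs, hs1⟩ := intermediate_value_Icc hb.1
      (hcont.mono (Set.Icc_subset_Icc_right hb.2)) ⟨hG0, hb1⟩
    exact ⟨s, hs, hs1⟩
  have hcompact : IsCompact (Set.Icc 0 T ∩ (fun s => |G s|) ⁻¹' {1}) :=
    isCompact_Icc.of_isClosed_subset (hcont.preimage_isClosed_of_isClosed isClosed_Icc
      isClosed_singleton) Set.inter_subset_left
  obtain ⟨s₁, hs₁, hs₁'⟩ := hcross t ht hc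
  obtain ⟨s₀, ⟨hs₀, hGs₀⟩, hleast⟩ := hcompact.exists_isLeast
    ⟨s₁, ⟨hs₁.1, hs₁.2.trans ht.2⟩, hs₁'⟩
  have hGs : ∀ s ∈ Set.Ico 0 s₀, |G s| ≤ 1 := by
    intro s hs
    by_contra! hs1
    obtain ⟨u, hu, hu1⟩ := hcross s ⟨hs.1, hs.2.le.trans hs₀.2⟩ hs1.le
    have := hleast ⟨⟨hu.1, hu.2.trans (hs.2.le.trans hs₀.2)⟩, hu1⟩
    linarith [hu.2, hs.2]
  have hN' : ∀ t ∈ Set.Icc 0 s₀, 0 ≤ N t := fun s hs => hN s ⟨hs.1, hs.2.trans hs₀.2⟩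
  have hmem : s₀ ∈ Set.Icc 0 s₀ := ⟨hs₀.1, le_rfl⟩
  have hρ1 : ρ s₀ ≤ 1 :=
    ((S.strictAntiOn_ρ_aux hN' hGs).antitoneOn ⟨le_rfl, hs₀.1⟩ hmem hs₀.1).trans S.ρ_zero
  have hρ0 := S.ρ_nonneg hN' hmem
  have hE := S.energy_eq hN' hmem
  have hr := S.four_le hN' hmem
  obtain ⟨hU1, hU2⟩ := S.U_bounds s₀ hr
  have hU0 : 0 ≤ U s₀ := le_trans (by positivity) hU1
  have hU3 : U s₀ ≤ 1 / 2 := hU2.trans (by rw [div_le_iff₀ (by linarith)]; linarith)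
  have hh := abs_le.1 S.abs_h
  have hG2 : G s₀ ^ 2 = 1 := by rw [← sq_abs, show |G s₀| = 1 from hGs₀]; norm_num
  rw [hG2] at hE
  have hr1 : 0 ≤ 1 / (2 * r s₀ ^ 2) := by positivity
  have hr2 : 1 / (2 * r s₀ ^ 2) ≤ 1 / 32 :=
    one_div_le_one_div_of_le (by norm_num) (by nlinarith)
  rcases (abs_eq zero_le_one).1 (show |G s₀| = 1 from hGs₀) with hG | hG <;> nlinarith

lemma strictAntiOn_ρ (S : RadialSystem μ h r N ρ G U) {T : ℝ} (hN : ∀ t ∈ Set.Icc 0 T, 0 ≤ N t) :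
    StrictAntiOn ρ (Set.Icc 0 T) :=
  S.strictAntiOn_ρ_aux hN fun _ ht => (S.abs_G_lt hN ⟨ht.1, ht.2.le⟩).le

/-- Total drift of the angular momentum along an outgoing motion. -/
lemma abs_G_le (S : RadialSystem μ h r N ρ G U) {T : ℝ} (hN : ∀ t ∈ Set.Icc 0 T, 0 ≤ N t) {t : ℝ}
    (ht : t ∈ Set.Icc 0 T) : |G t| ≤ |G 0| + 10 * μ := by
  have key : ∀ ε : ℝ, |ε| = 1 → AntitoneOn (fun s => ε * G s + 10 * μ * ρ s) (Set.Icc 0 T) := by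
    intro ε hε
    have hder : ∀ s ∈ Set.Icc 0 T, ∃ f,
        HasDerivAt (fun s => ε * G s + 10 * μ * ρ s) f s ∧ f ≤ 0 := by
      intro s hs
      have h4 := S.four_le hN hs
      obtain ⟨f, hf, hfb⟩ := S.hasDerivAt_ρ s h4
      obtain ⟨g, hg, hgb⟩ := S.hasDerivAt_G s h4
      refine ⟨_, (hg.const_mul ε).add (hf.const_mul (10 * μ)), ?_⟩
      have h1 := (hfb (S.abs_G_lt hN hs).le).2
      have h2 : ε * g ≤ 5 * μ / r s ^ 2 := by
        refine (le_abs_self _).trans ?_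
        rwa [abs_mul, hε, one_mul]
      have h3 := mul_le_mul_of_nonneg_left h1 (by linarith [S.μ_pos] : 0 ≤ 10 * μ)
      have h5 : 10 * μ * (-(1 / 2) / r s ^ 2) = -(5 * μ / r s ^ 2) := by ring
      linarith
    refine antitoneOn_of_deriv_nonpos (convex_Icc 0 T) (fun s hs => ?_) (fun s hs => ?_)
      (fun s hs => ?_)
    · obtain ⟨f, hf, -⟩ := hder s hs
      exact hf.continuousAt.continuousWithinAt
    · obtain ⟨f, hf, -⟩ := hder s (interior_subset hs)
      exact hf.differentiableAt.differentiableWithinAt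
    · obtain ⟨f, hf, hf0⟩ := hder s (interior_subset hs)
      rwa [hf.deriv]
  have hmem : (0 : ℝ) ∈ Set.Icc 0 T := ⟨le_rfl, ht.1.trans ht.2⟩
  have h1 := key 1 (by simp) hmem ht ht.1
  have h2 := key (-1) (by simp) hmem ht ht.1
  have h3 := S.ρ_nonneg hN ht
  have hμ := S.μ_pos
  have h4 : 10 * μ * ρ 0 ≤ 10 * μ := by nlinarith [S.ρ_zero]
  have h5 : 0 ≤ 10 * μ * ρ t := by positivity
  simp only [one_mul, neg_mul] at h1 h2
  rw [abs_le]
  constructor <;> linarith [neg_abs_le (G 0), le_abs_self (G 0)]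

/-- The function `ρ ^ 2 / 2 - 2 / r` does not decrease along an outgoing motion. -/
lemma monotoneOn_escape (S : RadialSystem μ h r N ρ G U) {T : ℝ}
    (hN : ∀ t ∈ Set.Icc 0 T, 0 ≤ N t) :
    MonotoneOn (fun s => ρ s ^ 2 / 2 - 2 / r s) (Set.Icc 0 T) := by
  have hder : ∀ s ∈ Set.Icc 0 T, ∃ f, HasDerivAt (fun s => ρ s ^ 2 / 2 - 2 / r s) f s ∧ 0 ≤ f := by
    intro s hs
    have h4 := S.four_le hN hs
    have hr : 0 < r s := by linarith
    obtain ⟨f, hf, hfb⟩ := S.hasDerivAt_ρ s h4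
    refine ⟨_, ((hf.fun_pow 2).div_const 2).fun_sub
      ((hasDerivAt_const s (2 : ℝ)).fun_div (S.hasDerivAt_r s h4) hr.ne'), ?_⟩
    have h1 := (hfb (S.abs_G_lt hN hs).le).1
    have h2 := S.ρ_nonneg hN hs
    have h3 := mul_le_mul_of_nonneg_left h1 h2
    have e : ρ s * (-2 / r s ^ 2) = -(2 * ρ s / r s ^ 2) := by ring
    rw [e] at h3
    norm_num
    have e2 : -(2 * ρ s) / r s ^ 2 = -(2 * ρ s / r s ^ 2) := by ring
    rw [e2]
    linarith
  refine monotoneOn_of_deriv_nonneg (convex_Icc 0 T) (fun s hs => ?_) (fun s hs => ?_)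
    (fun s hs => ?_)
  · obtain ⟨f, hf, -⟩ := hder s hs
    exact hf.continuousAt.continuousWithinAt
  · obtain ⟨f, hf, -⟩ := hder s (interior_subset hs)
    exact hf.differentiableAt.differentiableWithinAt
  · obtain ⟨f, hf, hf0⟩ := hder s (interior_subset hs)
    rwa [hf.deriv]

/-- A motion that never turns back goes to infinity. -/
lemma tendsto_r (S : RadialSystem μ h r N ρ G U) (hN : ∀ t, 0 ≤ t → 0 ≤ N t) :
    Tendsto r atTop atTop := by
  have hN' : ∀ T : ℝ, ∀ t ∈ Set.Icc 0 T, 0 ≤ N t := fun _ t ht => hN t ht.1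
  have hunb : ∀ R, ∃ t, 0 ≤ t ∧ R < r t := by
    intro R
    by_contra! hR
    have hR4 : 4 ≤ R := S.r_zero.trans (hR 0 le_rfl)
    have hR0 : 0 < R := by linarith
    set T := 4 * R ^ 2 with hT
    have hT0 : 0 ≤ T := by positivity
    have hanti : AntitoneOn (fun s => ρ s + (1 / 2) / R ^ 2 * s) (Set.Icc 0 T) := by
      have hder : ∀ s ∈ Set.Icc 0 T,
          ∃ f, HasDerivAt (fun s => ρ s + (1 / 2) / R ^ 2 * s) f s ∧ f ≤ 0 := by
        intro s hs
        have h4 := S.four_le (hN' T) hs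
        have hr : 0 < r s := by linarith
        obtain ⟨f, hf, hfb⟩ := S.hasDerivAt_ρ s h4
        refine ⟨_, hf.add ((hasDerivAt_id' s).const_mul _), ?_⟩
        have h1 := (hfb (S.abs_G_lt (hN' T) hs).le).2
        have h2 : (1 / 2) / R ^ 2 ≤ (1 / 2) / r s ^ 2 := by
          have := hR s hs.1
          gcongr
        have e : -(1 / 2) / r s ^ 2 = -((1 / 2) / r s ^ 2) := by ring
        rw [e] at h1
        linarith
      refine antitoneOn_of_deriv_nonpos (convex_Icc 0 T) (fun s hs => ?_) (fun s hs => ?_)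
        (fun s hs => ?_)
      · obtain ⟨f, hf, -⟩ := hder s hs
        exact hf.continuousAt.continuousWithinAt
      · obtain ⟨f, hf, -⟩ := hder s (interior_subset hs)
        exact hf.differentiableAt.differentiableWithinAt
      · obtain ⟨f, hf, hf0⟩ := hder s (interior_subset hs)
        rwa [hf.deriv]
    have h1 := hanti ⟨le_rfl, hT0⟩ ⟨hT0, le_rfl⟩ hT0
    have h2 := S.ρ_nonneg (hN' T) ⟨hT0, le_rfl⟩
    have h3 : (1 / 2) / R ^ 2 * T = 2 := by rw [hT]; field_simp; norm_num
    simp only [h3, mul_zero, add_zero] at h1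
    linarith [S.ρ_zero]
  refine tendsto_atTop.2 fun R => ?_
  obtain ⟨t, ht, hRt⟩ := hunb R
  filter_upwards [eventually_ge_atTop t] with s hs
  exact hRt.le.trans (S.monotoneOn_r (hN' s) ⟨ht, hs⟩ ⟨ht.trans hs, le_rfl⟩ hs)

/-- First zero of `N` after time `a`, for a motion outgoing at time `a`. -/
lemma exists_first_zero (S : RadialSystem μ h r N ρ G U) {a b : ℝ} (hab : a ≤ b) (ha : 0 < N a)
    (hb : N b ≤ 0) : ∃ c ∈ Set.Icc a b, N c = 0 ∧ ∀ t ∈ Set.Icc a c, 0 ≤ N t := by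
  have hcross : ∀ d, a ≤ d → N d ≤ 0 → ∃ s ∈ Set.Icc a d, N s = 0 := by
    intro d hd hd0
    obtain ⟨s, hs, hs0⟩ := intermediate_value_Icc' hd S.continuous_N.continuousOn ⟨hd0, ha.le⟩
    exact ⟨s, hs, hs0⟩
  have hcompact : IsCompact (Set.Icc a b ∩ N ⁻¹' {0}) :=
    isCompact_Icc.inter_right (isClosed_singleton.preimage S.continuous_N)
  obtain ⟨s, hs, hs0⟩ := hcross b hab hb
  obtain ⟨c, ⟨hc, hc0⟩, hleast⟩ := hcompact.exists_isLeast ⟨s, hs, hs0⟩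
  refine ⟨c, hc, hc0, fun t ht => ?_⟩
  by_contra! hneg
  obtain ⟨u, hu, hu0⟩ := hcross t ht.1 hneg.le
  have hcu : c ≤ u := hleast ⟨⟨hu.1, hu.2.trans (ht.2.trans hc.2)⟩, hu0⟩
  have : t = c := le_antisymm ht.2 (hcu.trans hu.2)
  rw [this] at hneg
  exact hneg.ne hc0

lemma nonneg_of_escape (S : RadialSystem μ h r N ρ G U) {t : ℝ} (ht : 0 ≤ t)
    (hN : ∀ s ∈ Set.Icc 0 t, 0 < N s) (hesc : 4 * r t < N t ^ 2) {s : ℝ} (hs : 0 ≤ s) :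
    0 ≤ N s := by
  by_contra! hneg
  have hts : t ≤ s := by
    by_contra! hc
    exact (hN s ⟨hs, hc.le⟩).not_gt hneg
  obtain ⟨c, hc, hc0, hcN⟩ := S.exists_first_zero hts (hN t ⟨ht, le_rfl⟩) hneg.le
  have hN' : ∀ u ∈ Set.Icc 0 c, 0 ≤ N u := by
    intro u hu
    rcases le_total u t with hut | hut
    · exact (hN u ⟨hu.1, hut⟩).le
    · exact hcN u ⟨hut, hu.2⟩
  have htc : t ∈ Set.Icc 0 c := ⟨ht, hc.1⟩
  have hcc : c ∈ Set.Icc 0 c := ⟨ht.trans hc.1, le_rfl⟩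
  have hmono := S.monotoneOn_escape hN' htc hcc hc.1
  have h4t := S.four_le hN' htc
  have h4c := S.four_le hN' hcc
  have hρc : ρ c = 0 := by
    rw [S.N_eq c h4c] at hc0
    exact (mul_eq_zero.1 hc0).resolve_left (by linarith)
  rw [S.N_eq t h4t] at hesc
  have hrt : 0 < r t := by linarith
  have h1 : 0 < ρ t ^ 2 / 2 - 2 / r t := by
    rw [sub_pos, div_lt_div_iff₀ hrt two_pos]
    nlinarith
  have h2 : 0 < 2 / r c := by positivity
  simp only [hρc] at hmono
  linarith

lemma exists_escape (S : RadialSystem μ h r N ρ G U) (hh : |G 0| + 10 * μ < h) :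
    ∃ t, 0 ≤ t ∧ (∀ s ∈ Set.Icc 0 t, 0 < N s) ∧ 4 * r t < N t ^ 2 := by
  have hpos : ∀ t, 0 ≤ t → 0 < N t := by
    intro t ht
    by_contra! hneg
    obtain ⟨c, hc, hc0, hcN⟩ := S.exists_first_zero ht S.N_zero hneg
    have hcc : c ∈ Set.Icc 0 c := ⟨hc.1, le_rfl⟩
    have h4 := S.four_le hcN hcc
    have hρc : ρ c = 0 := by
      rw [S.N_eq c h4] at hc0
      exact (mul_eq_zero.1 hc0).resolve_left (by linarith)
    have hE := S.energy_eq hcN hcc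
    have hG := S.abs_G_le hcN hcc
    have hG1 := S.abs_G_lt hcN hcc
    have hU := (S.U_bounds c h4).1
    have hG2 : G c ^ 2 / (2 * r c ^ 2) ≤ 1 / (2 * r c ^ 2) := by
      gcongr
      rw [← sq_abs]
      nlinarith [abs_nonneg (G c)]
    rw [hρc] at hE
    linarith [neg_abs_le (G c)]
  have hN' : ∀ T : ℝ, ∀ t ∈ Set.Icc 0 T, 0 ≤ N t := fun _ t ht => (hpos t ht.1).le
  set η := h - (|G 0| + 10 * μ) with hη
  have hη0 : 0 < η := sub_pos.2 hh
  obtain ⟨t, htr, ht⟩ := (((S.tendsto_r fun t ht => (hpos t ht).le).eventually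
    (eventually_gt_atTop (2 / η))).and (eventually_ge_atTop 0)).exists
  refine ⟨t, ht, fun s hs => hpos s hs.1, ?_⟩
  have htt : t ∈ Set.Icc 0 t := ⟨ht, le_rfl⟩
  have h4 := S.four_le (hN' t) htt
  have hE := S.energy_eq (hN' t) htt
  have hG := S.abs_G_le (hN' t) htt
  have hG1 := S.abs_G_lt (hN' t) htt
  have hU := (S.U_bounds t h4).1
  have hG2 : G t ^ 2 / (2 * r t ^ 2) ≤ 1 / (2 * r t ^ 2) := by
    gcongr
    rw [← sq_abs]
    nlinarith [abs_nonneg (G t)]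
  have hρ : 2 * η ≤ ρ t ^ 2 := by linarith [neg_abs_le (G t)]
  rw [div_lt_iff₀ hη0] at htr
  rw [S.N_eq t h4]
  have : 2 * η * r t ^ 2 ≤ ρ t ^ 2 * r t ^ 2 := by gcongr
  nlinarith

lemma exists_return (S : RadialSystem μ h r N ρ G U) (hh : h < -(|G 0| + 10 * μ)) :
    ∃ t, 0 ≤ t ∧ N t < 0 := by
  by_contra! hN
  have hN' : ∀ T : ℝ, ∀ t ∈ Set.Icc 0 T, 0 ≤ N t := fun _ t ht => hN t ht.1
  set η := -(|G 0| + 10 * μ) - h with hη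
  have hη0 : 0 < η := sub_pos.2 hh
  obtain ⟨t, htr, ht⟩ := (((S.tendsto_r hN).eventually
    (eventually_gt_atTop (2 / η))).and (eventually_ge_atTop 0)).exists
  have htt : t ∈ Set.Icc 0 t := ⟨ht, le_rfl⟩
  have h4 := S.four_le (hN' t) htt
  have hE := S.energy_eq (hN' t) htt
  have hG := S.abs_G_le (hN' t) htt
  have hU := (S.U_bounds t h4).2
  have hG2 : 0 ≤ G t ^ 2 / (2 * r t ^ 2) := by positivity
  have hUη : η ≤ U t := by nlinarith [le_abs_self (G t), sq_nonneg (ρ t)]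
  have hr0 : 0 < r t := by linarith
  rw [div_lt_iff₀ hη0] at htr
  have := hUη.trans hU
  rw [le_div_iff₀ hr0] at this
  linarith

/-- A motion which neither escapes with positive limit velocity nor returns is parabolic. -/
lemma tendsto_of_not_escape (S : RadialSystem μ h r N ρ G U)
    (hesc : ¬ ∃ t, 0 ≤ t ∧ (∀ s ∈ Set.Icc 0 t, 0 < N s) ∧ 4 * r t < N t ^ 2)
    (hret : ¬ ∃ t, 0 ≤ t ∧ N t < 0) :
    (∀ t, 0 ≤ t → 4 ≤ r t) ∧ Tendsto r atTop atTop ∧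
      Tendsto (fun t => ρ t ^ 2 + G t ^ 2 / r t ^ 2) atTop (𝓝 0) := by
  push Not at hret
  have hN' : ∀ T : ℝ, ∀ t ∈ Set.Icc 0 T, 0 ≤ N t := fun _ t ht => hret t ht.1
  have h4 : ∀ t, 0 ≤ t → 4 ≤ r t := fun t ht => S.four_le (hN' t) ⟨ht, le_rfl⟩
  have hr := S.tendsto_r hret
  have hpos : ∀ t, 0 ≤ t → 0 < N t := by
    intro t ht
    have h1 := S.strictAntiOn_ρ (hN' (t + 1)) (a := t) (b := t + 1) ⟨ht, by linarith⟩
      ⟨by linarith, le_rfl⟩ (by linarith)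
    have h2 := S.ρ_nonneg (hN' (t + 1)) (t := t + 1) ⟨by linarith, le_rfl⟩
    rw [S.N_eq t (h4 t ht)]
    have := h4 t ht
    nlinarith
  have hbound : ∀ t, 0 ≤ t → ρ t ^ 2 + G t ^ 2 / r t ^ 2 ≤ 5 / r t := by
    intro t ht
    have hle : N t ^ 2 ≤ 4 * r t := by
      by_contra! hc
      exact hesc ⟨t, ht, fun s hs => hpos s hs.1, hc⟩
    have h4t := h4 t ht
    have hr0 : 0 < r t := by linarith
    rw [S.N_eq t h4t] at hle
    have h1 : ρ t ^ 2 ≤ 4 / r t := by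
      rw [le_div_iff₀ hr0]
      nlinarith
    have h2 : G t ^ 2 / r t ^ 2 ≤ 1 / r t := by
      rw [div_le_div_iff₀ (by positivity) hr0]
      have : G t ^ 2 ≤ 1 := by
        rw [← sq_abs]
        nlinarith [abs_nonneg (G t), S.abs_G_lt (hN' t) ⟨ht, le_rfl⟩]
      nlinarith
    have e : 5 / r t = 4 / r t + 1 / r t := by ring
    linarith
  refine ⟨h4, hr, squeeze_zero' (Eventually.of_forall fun t => by positivity)
    ((eventually_ge_atTop 0).mono fun t ht => hbound t ht) (hr.const_div_atTop 5)⟩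

end RadialSystem

end RadialSystem

section FarFlow

/-- The field of the PCRTBP on `ℂ × ℂ`, softened near the primaries. -/
noncomputable def farField (μ : ℝ) (X : ℂ × ℂ) : ℂ × ℂ :=
  (X.2 - Complex.I * X.1,
    -Complex.I * X.2 - (1 - μ) * softKernel 1 (X.1 + μ) - μ * softKernel 1 (X.1 - (1 - μ)))

lemma exists_lipschitzWith_farField (μ : ℝ) : ∃ K, LipschitzWith K (farField μ) := by
  have hmul : ∀ (c : ℂ) (f : ℂ × ℂ → ℂ), (∃ K, LipschitzWith K f) →
      ∃ K, LipschitzWith K fun X => c * f X := by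
    rintro c f ⟨K, hK⟩
    exact ⟨_, (lipschitzWith_smul c).comp hK⟩
  have hker : ∀ c : ℂ, ∃ K, LipschitzWith K fun X : ℂ × ℂ => softKernel 1 (X.1 + c) := by
    intro c
    exact ⟨_, (lipschitzWith_softKernel one_pos).comp
      (LipschitzWith.prod_fst.add (LipschitzWith.const c))⟩
  obtain ⟨K₁, h₁⟩ := hmul Complex.I _ ⟨_, LipschitzWith.prod_fst⟩
  obtain ⟨K₂, h₂⟩ := hmul (-Complex.I) _ ⟨_, LipschitzWith.prod_snd⟩
  obtain ⟨K₃, h₃⟩ := hmul (1 - μ) _ (hker μ)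
  obtain ⟨K₄, h₄⟩ := hmul μ _ (hker (-(1 - μ)))
  exact ⟨_, (LipschitzWith.prod_snd.sub h₁).prodMk ((h₂.sub h₃).sub h₄)⟩

lemma farField_eq {μ : ℝ} (hμ : 0 < μ) (hμ' : μ < 1 / 100) {X : ℂ × ℂ} (h : 4 ≤ ‖X.1‖) :
    farField μ X = (X.2 - Complex.I * X.1, momentumField μ X.1 X.2) := by
  rw [← nrm2_eq_norm] at h
  have hS := (dS_far_bounds hμ hμ' h).1
  have hJ := dJ_far_bound hμ hμ' h
  rw [dS_eq_norm] at hS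
  rw [dJ_eq_norm] at hJ
  rw [farField, momentumField, softKernel_of_le (by linarith), softKernel_of_le (by linarith)]

lemma solvesAt_far {μ : ℝ} (hμ : 0 < μ) (hμ' : μ < 1 / 100) {Y : ℝ → ℂ × ℂ} {t : ℝ}
    (hY : HasDerivAt Y (farField μ (Y t)) t) (ht : 4 ≤ ‖(Y t).1‖) : SolvesAt μ Y t := by
  rw [farField_eq hμ hμ' ht] at hY
  rw [← nrm2_eq_norm] at ht
  have hS := (dS_far_bounds hμ hμ' ht).1
  have hJ := dJ_far_bound hμ hμ' ht
  rw [dS_eq_norm] at hS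
  rw [dJ_eq_norm] at hJ
  exact ⟨norm_pos_iff.1 (by linarith), norm_pos_iff.1 (by linarith), hY.fst, hY.snd⟩

/-- Half the rate of change of the squared distance to the origin. -/
noncomputable def outflow (X : ℂ × ℂ) : ℝ := X.1.re * X.2.re + X.1.im * X.2.im

lemma continuous_outflow : Continuous outflow := by
  unfold outflow
  fun_prop

/-- Angular momentum about the origin. -/
noncomputable def angularMomentum (X : ℂ × ℂ) : ℝ := X.1.re * X.2.im - X.1.im * X.2.re

/-- Data from which the motion is shown to stay in the far region as long as it is outgoing. -/
structure IsFarStart (μ h g : ℝ) (X : ℂ × ℂ) : Prop where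
  four_le : 4 ≤ ‖X.1‖
  outflow_pos : 0 < outflow X
  outflow_le : outflow X ≤ ‖X.1‖
  abs_angularMomentum_le : |angularMomentum X| ≤ g
  ham_eq : Ham μ X.1.re X.1.im X.2.re X.2.im = h

lemma radialSystem_far {μ h g : ℝ} (hμ : 0 < μ) (hμ' : μ < 1 / 100) (hg : g < 1 / 2)
    (hh : |h| ≤ 1 / 10) {Y : ℝ → ℂ × ℂ} (hY : ∀ t, HasDerivAt Y (farField μ (Y t)) t)
    (h0 : IsFarStart μ h g (Y 0)) :
    RadialSystem μ h (fun t => ‖(Y t).1‖) (fun t => outflow (Y t))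
      (fun t => outflow (Y t) / ‖(Y t).1‖) (fun t => angularMomentum (Y t))
      (fun t => potential μ (Y t).1.re (Y t).1.im) := by
  have hsol := SolvesAt.isPCRTBPSol (I := {t | 4 ≤ ‖(Y t).1‖}) fun t => solvesAt_far hμ hμ' (hY t)
  have hcont : Continuous Y := continuous_iff_continuousAt.2 fun t => (hY t).continuousAt
  have hpos : ∀ t, 4 ≤ ‖(Y t).1‖ → 0 < nrm2 (Y t).1.re (Y t).1.im := fun t ht => by
    rw [nrm2_eq_norm]; linarith
  have hpolar : ∀ t, 0 < ‖(Y t).1‖ →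
      Ham μ (Y t).1.re (Y t).1.im (Y t).2.re (Y t).2.im
      = (outflow (Y t) / ‖(Y t).1‖) ^ 2 / 2
        + angularMomentum (Y t) ^ 2 / (2 * ‖(Y t).1‖ ^ 2) - angularMomentum (Y t)
        - potential μ (Y t).1.re (Y t).1.im := fun t ht => by
    rw [ham_eq_polar _ _ (by rwa [nrm2_eq_norm]), nrm2_eq_norm]; rfl
  refine
    { nonneg := fun t => norm_nonneg _
      continuous_N := continuous_outflow.comp hcont
      hasDerivAt_sq := fun t => ?_
      N_eq := fun t ht => ?_
      hasDerivAt_r := fun t ht => ?_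
      hasDerivAt_ρ := fun t ht => ?_
      hasDerivAt_G := fun t ht => ?_
      hasDerivAt_energy := fun t ht => ?_
      U_bounds := fun t ht => ?_
      r_zero := h0.four_le
      ρ_zero := (div_le_one (by linarith [h0.four_le])).2 h0.outflow_le
      N_zero := h0.outflow_pos
      G_zero := h0.abs_angularMomentum_le.trans_lt hg
      energy_zero := by rw [← hpolar 0 (by linarith [h0.four_le]), h0.ham_eq]
      abs_h := hh
      μ_pos := hμ }
  · have h1 : HasDerivAt (fun s => (Y s).1) ((Y t).2 - Complex.I * (Y t).1) t := (hY t).fst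
    have h2 := ((h1.complex_re).fun_pow 2).fun_add ((h1.complex_im).fun_pow 2)
    have e : (fun s => ‖(Y s).1‖ ^ 2) = fun s => (Y s).1.re ^ 2 + (Y s).1.im ^ 2 := by
      funext s
      rw [← nrm2_eq_norm, nrm2_sq]
    rw [e]
    refine h2.congr_deriv ?_
    simp [outflow]
    ring
  · field_simp [show ‖(Y t).1‖ ≠ 0 by linarith]
  · simpa only [nrm2_eq_norm, outflow] using hsol.hasDerivAt_nrm2 ht (hpos t ht)
  · have := hsol.hasDerivAt_radialVelocity ht (hpos t ht)
    simp only [nrm2_eq_norm] at this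
    refine ⟨_, this, fun hG => ?_⟩
    have := radialForce_bounds (x := (Y t).1.re) (y := (Y t).1.im) hμ hμ'
      (by rwa [nrm2_eq_norm]) hG
    rwa [nrm2_eq_norm] at this
  · refine ⟨_, hsol.hasDerivAt_angularMomentum ht, ?_⟩
    have := abs_torque_le (x := (Y t).1.re) (y := (Y t).1.im) hμ hμ' (by rwa [nrm2_eq_norm])
    rwa [nrm2_eq_norm] at this
  · refine (hsol.hasDerivAt_ham ht).congr_of_eventuallyEq ?_
    have hc : ContinuousAt (fun s => ‖(Y s).1‖) t := by fun_prop
    filter_upwards [hc.eventually (lt_mem_nhds (show (0 : ℝ) < ‖(Y t).1‖ by linarith))] with s hs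
    exact (hpolar s hs).symm
  · have := potential_bounds (x := (Y t).1.re) (y := (Y t).1.im) hμ hμ' (by rwa [nrm2_eq_norm])
    rwa [nrm2_eq_norm] at this

/-- In a continuous one-parameter family of initial data ranging from energies with orbits that
return to energies with orbits that escape, some orbit is parabolic. -/
theorem exists_parabolic_far {μ g a b : ℝ} (hμ : 0 < μ) (hμ' : μ < 1 / 100) (hg0 : 0 ≤ g)
    (hg : g < 1 / 2)
    (ha : a < -(g + 10 * μ)) (hb : g + 10 * μ < b) (hI : ∀ h ∈ Set.Icc a b, |h| ≤ 1 / 10)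
    {X : ℝ → ℂ × ℂ} (hX : ContinuousOn X (Set.Icc a b))
    (hstart : ∀ h ∈ Set.Icc a b, IsFarStart μ h g (X h)) :
    ∃ h ∈ Set.Icc a b, ∃ Y : ℝ → ℂ × ℂ, Y 0 = X h ∧
      (∀ t, HasDerivAt Y (farField μ (Y t)) t) ∧ (∀ t, 0 ≤ t → 4 ≤ ‖(Y t).1‖) ∧
      Tendsto (fun t => ‖(Y t).1‖) atTop atTop ∧ Tendsto (fun t => ‖(Y t).2‖) atTop (𝓝 0) := by
  obtain ⟨K, hK⟩ := exists_lipschitzWith_farField μ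
  obtain ⟨Φ, hΦ0, hΦ, hΦc⟩ := exists_continuous_flow hK
  have hab : a ≤ b := by linarith
  have hsys : ∀ h ∈ Set.Icc a b, RadialSystem μ h (fun t => ‖(Φ (X h) t).1‖)
      (fun t => outflow (Φ (X h) t)) (fun t => outflow (Φ (X h) t) / ‖(Φ (X h) t).1‖)
      (fun t => angularMomentum (Φ (X h) t))
      (fun t => potential μ (Φ (X h) t).1.re (Φ (X h) t).1.im) := fun h hh =>
    radialSystem_far hμ hμ' hg (hI h hh) (hΦ _) (by rw [hΦ0]; exact hstart h hh)
  have hG0 : ∀ h ∈ Set.Icc a b, |angularMomentum (Φ (X h) 0)| ≤ g := fun h hh => by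
    rw [hΦ0]; exact (hstart h hh).abs_angularMomentum_le
  set A : Set (ℂ × ℂ) := {x | ∃ t, 0 ≤ t ∧ (∀ s ∈ Set.Icc 0 t, 0 < outflow (Φ x s)) ∧
    4 * ‖(Φ x t).1‖ < outflow (Φ x t) ^ 2} with hA
  set B : Set (ℂ × ℂ) := {x | ∃ t, 0 ≤ t ∧ outflow (Φ x t) < 0} with hB
  have hΦt : ∀ t, Continuous fun x => Φ x t := fun t =>
    hΦc.comp (continuous_id.prodMk continuous_const)
  have hAo : IsOpen A := by
    refine isOpen_iff_mem_nhds.2 fun x ⟨t, ht, hpos, hesc⟩ => ?_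
    have h1 : ∀ᶠ x' in 𝓝 x, ∀ s ∈ Set.Icc 0 t, 0 < outflow (Φ x' s) := by
      refine isCompact_Icc.eventually_forall_of_forall_eventually fun s hs => ?_
      exact (continuous_outflow.comp hΦc).continuousAt.eventually (lt_mem_nhds (hpos s hs))
    have h2 : ∀ᶠ x' in 𝓝 x, 4 * ‖(Φ x' t).1‖ < outflow (Φ x' t) ^ 2 := by
      have hc := hΦt t
      have hc' := continuous_outflow.comp hc
      exact (isOpen_lt (by fun_prop) (hc'.pow 2)).mem_nhds hesc
    filter_upwards [h1, h2] with x' h1 h2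
    exact ⟨t, ht, h1, h2⟩
  have hBo : IsOpen B := by
    refine isOpen_iff_mem_nhds.2 fun x ⟨t, ht, hneg⟩ => ?_
    filter_upwards [(isOpen_lt (continuous_outflow.comp (hΦt t)) continuous_const).mem_nhds hneg]
      with x' hx'
    exact ⟨t, ht, hx'⟩
  have hnot : ∃ h ∈ Set.Icc a b, X h ∉ A ∧ X h ∉ B := by
    by_contra! hcov
    obtain ⟨x, ⟨h, hh, rfl⟩, hxA, hxB⟩ := (isPreconnected_Icc.image X hX) A B hAo hBo
      (by
        rintro _ ⟨h, hh, rfl⟩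
        by_cases hhA : X h ∈ A
        · exact Or.inl hhA
        · exact Or.inr (hcov h hh hhA))
      ⟨X b, ⟨b, ⟨hab, le_rfl⟩, rfl⟩, (hsys b ⟨hab, le_rfl⟩).exists_escape (by
        linarith [hG0 b ⟨hab, le_rfl⟩])⟩
      ⟨X a, ⟨a, ⟨le_rfl, hab⟩, rfl⟩, (hsys a ⟨le_rfl, hab⟩).exists_return (by
        linarith [hG0 a ⟨le_rfl, hab⟩])⟩
    obtain ⟨t, ht, hpos, hesc⟩ := hxA
    obtain ⟨s, hs, hneg⟩ := hxB
    exact hneg.not_ge ((hsys h hh).nonneg_of_escape ht hpos hesc hs)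
  obtain ⟨h, hh, hhA, hhB⟩ := hnot
  obtain ⟨h4, hr, hp⟩ := (hsys h hh).tendsto_of_not_escape hhA hhB
  refine ⟨h, hh, Φ (X h), hΦ0 _, hΦ _, h4, hr, ?_⟩
  have hsq : ∀ t, 0 ≤ t → (outflow (Φ (X h) t) / ‖(Φ (X h) t).1‖) ^ 2
      + angularMomentum (Φ (X h) t) ^ 2 / ‖(Φ (X h) t).1‖ ^ 2 = ‖(Φ (X h) t).2‖ ^ 2 := by
    intro t ht
    have hne : ‖(Φ (X h) t).1‖ ≠ 0 := by linarith [h4 t ht]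
    rw [div_pow, ← add_div, div_eq_iff (pow_ne_zero 2 hne), outflow, angularMomentum,
      ← nrm2_eq_norm, ← nrm2_eq_norm, nrm2_sq, nrm2_sq]
    ring
  have h2 : Tendsto (fun t => ‖(Φ (X h) t).2‖ ^ 2) atTop (𝓝 0) :=
    hp.congr' ((eventually_ge_atTop 0).mono hsq)
  have h3 := h2.sqrt
  simpa [Real.sqrt_sq (norm_nonneg _)] using h3

end FarFlow

section Components

variable {E F : Type*} [NormedAddCommGroup E] [NormedSpace ℝ E] [NormedAddCommGroup F]
  [NormedSpace ℝ F] {f : ℝ → E × F} {f' : E × F} {t : ℝ}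

lemma HasDerivAt.fst_component (h : HasDerivAt f f' t) : HasDerivAt (fun s => (f s).1) f'.1 t :=
  ((ContinuousLinearMap.fst ℝ E F).hasFDerivAt (x := f t)).comp_hasDerivAt t h

lemma HasDerivAt.snd_component (h : HasDerivAt f f' t) : HasDerivAt (fun s => (f s).2) f'.2 t :=
  ((ContinuousLinearMap.snd ℝ E F).hasFDerivAt (x := f t)).comp_hasDerivAt t h

end Components

section NearField

/-- Perturbing acceleration (divided by `μ`) felt at position `y` relative to the first primary, at
time `t`, in inertial axes; the direct term is softened at distances below `1 / 2`. -/
noncomputable def perturbation (y : ℂ) (t : ℝ) : ℂ :=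
  -softKernel (1 / 2) (y - Complex.exp (t * Complex.I)) - Complex.exp (t * Complex.I)

lemma norm_perturbation_le (y : ℂ) (t : ℝ) : ‖perturbation y t‖ ≤ 5 := by
  have h1 := norm_softKernel_le (d := 1 / 2) (by norm_num) (y - Complex.exp (t * Complex.I))
  have h2 := norm_sub_le (-softKernel (1 / 2) (y - Complex.exp (t * Complex.I)))
    (Complex.exp (t * Complex.I))
  rw [norm_neg, Complex.norm_exp_ofReal_mul_I] at h2
  norm_num at h1
  rw [perturbation]
  linarith

/-- Levi-Civita regularization of the problem at the first primary, in inertial axes, for the state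
`(w, v, E, t)`: position `w ^ 2`, parametric velocity `v`, Kepler energy `E` and time `t`. -/
noncomputable def regularizedField (μ : ℝ) (X : ℂ × ℂ × ℝ × ℝ) : ℂ × ℂ × ℝ × ℝ :=
  (X.2.1,
    X.2.2.1 * X.1 * (1 / 2)
      + μ / 2 * (X.1 * conj X.1 * conj X.1 * perturbation (X.1 * X.1) X.2.2.2),
    2 * μ * (conj (X.1 * X.2.1) * perturbation (X.1 * X.1) X.2.2.2).re,
    (X.1 * conj X.1).re)

/-- Truncation of the state to a bounded region (the time is left unchanged). -/
noncomputable def truncateState (X : ℂ × ℂ × ℝ × ℝ) : ℂ × ℂ × ℝ × ℝ :=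
  (radialRetract 4 X.1, radialRetract 4 X.2.1, radialRetract 1 X.2.2.1, X.2.2.2)

lemma exists_lipschitzWith_nearField (μ : ℝ) :
    ∃ K, LipschitzWith K fun X => regularizedField μ (truncateState X) := by
  have hw : BddLipschitz fun X : ℂ × ℂ × ℝ × ℝ => radialRetract 4 X.1 :=
    .radialRetract_comp (by norm_num) LipschitzWith.prod_fst
  have hv : BddLipschitz fun X : ℂ × ℂ × ℝ × ℝ => radialRetract 4 X.2.1 :=
    .radialRetract_comp (by norm_num) (LipschitzWith.prod_fst.comp LipschitzWith.prod_snd)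
  have hE : BddLipschitz fun X : ℂ × ℂ × ℝ × ℝ => radialRetract 1 X.2.2.1 :=
    .radialRetract_comp (by norm_num)
      (LipschitzWith.prod_fst.comp (LipschitzWith.prod_snd.comp LipschitzWith.prod_snd))
  have he : BddLipschitz fun X : ℂ × ℂ × ℝ × ℝ => Complex.exp (X.2.2.2 * Complex.I) :=
    .exp_mul_I
      (LipschitzWith.prod_snd.comp (LipschitzWith.prod_snd.comp LipschitzWith.prod_snd))
  have hg : BddLipschitz fun X : ℂ × ℂ × ℝ × ℝ =>
      perturbation (radialRetract 4 X.1 * radialRetract 4 X.1) X.2.2.2 :=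
    (BddLipschitz.of_bound (lipschitzWith_softKernel (by norm_num)) ((hw.mul hw).sub he)).neg.sub he
  have h : BddLipschitz fun X => regularizedField μ (truncateState X) :=
    hv.prodMk ((((hE.ofReal.mul hw).mul (.const _)).add
      ((BddLipschitz.const _).mul (((hw.mul hw.star_comp).mul hw.star_comp).mul hg))).prodMk
      (((BddLipschitz.const _).mul ((hw.mul hv).star_comp.mul hg).re).prodMk
        (hw.mul hw.star_comp).re))
  exact h.1

end NearField

section NearEstimates

variable {μ h : ℝ}

/-- Kepler energy at the collision corresponding to the value `h` of the Hamiltonian. -/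
noncomputable def collisionEnergy (μ h : ℝ) : ℝ := h + μ + μ ^ 2 / 2

/-- Parametric speed at the collision. -/
noncomputable def collisionSpeed (μ : ℝ) : ℝ := √((1 - μ) / 2)

/-- Initial state of the ejection orbit leaving the primary in the direction opposite to the second
primary. -/
noncomputable def collisionState (μ h : ℝ) : ℂ × ℂ × ℝ × ℝ :=
  (0, collisionSpeed μ * Complex.I, collisionEnergy μ h, 0)

lemma collisionSpeed_sq (hμ' : μ < 1) : collisionSpeed μ ^ 2 = (1 - μ) / 2 :=
  Real.sq_sqrt (by linarith)

lemma collisionSpeed_bounds (hμ : 0 < μ) (hμ' : μ < 1 / 100000000) :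
    7 / 10 ≤ collisionSpeed μ ∧ collisionSpeed μ ≤ 708 / 1000 :=
  ⟨Real.le_sqrt_of_sq_le (by norm_num; linarith), Real.sqrt_le_iff.2 ⟨by norm_num, by linarith⟩⟩

lemma abs_collisionEnergy_le (hμ : 0 < μ) (hμ' : μ < 1 / 100000000) (hh : |h| ≤ 4000 * μ) :
    |collisionEnergy μ h| ≤ 4002 * μ := by
  have := abs_le.1 hh
  rw [collisionEnergy, abs_le]
  constructor <;> nlinarith

/-- A solution of the regularized equations issuing from the collision, with the a priori bounds
showing that no truncation is active. -/
structure IsEjection (μ h : ℝ) (X : ℝ → ℂ × ℂ × ℝ × ℝ) : Prop where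
  zero : X 0 = collisionState μ h
  hasDerivAt : ∀ τ ∈ Set.Icc (0 : ℝ) 4, HasDerivAt X (regularizedField μ (X τ)) τ
  velocity : ∀ τ ∈ Set.Icc (0 : ℝ) 4, ‖(X τ).2.1 - collisionSpeed μ * Complex.I‖ ≤ 1 / 1000
  position : ∀ τ ∈ Set.Icc (0 : ℝ) 4, ‖(X τ).1 - τ * (collisionSpeed μ * Complex.I)‖ ≤ 1 / 1000 * τ

lemma isEjection_of_solution (hμ : 0 < μ) (hμ' : μ < 1 / 100000000) (hh : |h| ≤ 4000 * μ)
    {X : ℝ → ℂ × ℂ × ℝ × ℝ} (h0 : X 0 = collisionState μ h)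
    (hX : ∀ τ, HasDerivAt X (regularizedField μ (truncateState (X τ))) τ) : IsEjection μ h X := by
  obtain ⟨ha1, ha2⟩ := collisionSpeed_bounds hμ hμ'
  have hbw : ∀ τ, ‖(truncateState (X τ)).1‖ ≤ 4 := fun τ => norm_radialRetract_le (by norm_num) _
  have hbv : ∀ τ, ‖(truncateState (X τ)).2.1‖ ≤ 4 := fun τ => norm_radialRetract_le (by norm_num) _
  have hE' : ∀ τ, ‖(regularizedField μ (truncateState (X τ))).2.2.1‖ ≤ 160 * μ := by
    intro τ
    rw [regularizedField, Real.norm_eq_abs, abs_mul, abs_of_pos (by positivity)]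
    have h1 := Complex.abs_re_le_norm (conj ((truncateState (X τ)).1 * (truncateState (X τ)).2.1)
      * perturbation ((truncateState (X τ)).1 * (truncateState (X τ)).1)
        (truncateState (X τ)).2.2.2)
    rw [norm_mul, Complex.norm_conj, norm_mul] at h1
    have h2 : ‖(truncateState (X τ)).1‖ * ‖(truncateState (X τ)).2.1‖
        * ‖perturbation ((truncateState (X τ)).1 * (truncateState (X τ)).1)
        (truncateState (X τ)).2.2.2‖ ≤ 4 * 4 * 5 := by
      gcongr
      exacts [hbw τ, hbv τ, norm_perturbation_le _ _]
    nlinarith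
  have hEb : ∀ τ ∈ Set.Icc (0 : ℝ) 4, |(X τ).2.2.1| ≤ 4642 * μ := by
    intro τ hτ
    have h1 := norm_image_sub_le_of_norm_deriv_le_segment' (f := fun s => (X s).2.2.1) (a := 0)
      (b := 4) (fun s _ => ((hX s).snd_component.snd_component.fst_component).hasDerivWithinAt)
      (fun s _ => hE' s) τ hτ
    rw [Real.norm_eq_abs, h0] at h1
    have h2 := abs_collisionEnergy_le hμ hμ' hh
    simp only [collisionState] at h1
    have h3 := abs_le.1 h1
    have h4 := abs_le.1 h2
    have h5 : 160 * μ * (τ - 0) ≤ 640 * μ := by nlinarith [hτ.2]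
    rw [abs_le]
    constructor <;> linarith
  have hv' : ∀ τ ∈ Set.Icc (0 : ℝ) 4,
      ‖(regularizedField μ (truncateState (X τ))).2.1‖ ≤ 9444 * μ := by
    intro τ hτ
    rw [regularizedField]
    refine (norm_add_le _ _).trans ?_
    simp only [norm_mul, Complex.norm_conj]
    have h1 : ‖((truncateState (X τ)).2.2.1 : ℂ)‖ ≤ 4642 * μ := by
      rw [Complex.norm_real]
      exact (norm_radialRetract_le_norm one_pos _).trans (hEb τ hτ)
    have h2 : ‖((truncateState (X τ)).2.2.1 : ℂ)‖ * ‖(truncateState (X τ)).1‖ * ‖(1 / 2 : ℂ)‖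
        ≤ 4642 * μ * 4 * (1 / 2) := by
      gcongr
      · exact hbw τ
      · norm_num
    have h3 : ‖(μ / 2 : ℂ)‖ * (‖(truncateState (X τ)).1‖ * ‖(truncateState (X τ)).1‖
        * ‖(truncateState (X τ)).1‖
        * ‖perturbation ((truncateState (X τ)).1 * (truncateState (X τ)).1)
          (truncateState (X τ)).2.2.2‖) ≤ μ / 2 * (4 * 4 * 4 * 5) := by
      have e : ‖(μ / 2 : ℂ)‖ = μ / 2 := by
        rw [norm_div, Complex.norm_real, Real.norm_of_nonneg hμ.le]; norm_num
      rw [e]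
      gcongr
      exacts [hbw τ, hbw τ, hbw τ, norm_perturbation_le _ _]
    linarith
  have hv : ∀ τ ∈ Set.Icc (0 : ℝ) 4, ‖(X τ).2.1 - collisionSpeed μ * Complex.I‖ ≤ 1 / 1000 := by
    intro τ hτ
    have h1 := norm_image_sub_le_of_norm_deriv_le_segment' (f := fun s => (X s).2.1) (a := 0)
      (b := 4) (fun s _ => ((hX s).snd_component.fst_component).hasDerivWithinAt)
      (fun s hs => hv' s ⟨hs.1, hs.2.le⟩) τ hτ
    rw [h0] at h1
    refine h1.trans ?_
    have := hτ.2
    have := hτ.1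
    nlinarith
  have hspeed : ‖(collisionSpeed μ * Complex.I : ℂ)‖ ≤ 708 / 1000 := by
    rw [norm_mul, Complex.norm_I, mul_one, Complex.norm_real, Real.norm_of_nonneg (by linarith)]
    exact ha2
  have hvb : ∀ τ ∈ Set.Icc (0 : ℝ) 4, ‖(X τ).2.1‖ ≤ 71 / 100 := by
    intro τ hτ
    have h1 := norm_le_norm_add_norm_sub (collisionSpeed μ * Complex.I : ℂ) (X τ).2.1
    rw [norm_sub_rev] at h1
    linarith [hv τ hτ]
  have hw : ∀ τ ∈ Set.Icc (0 : ℝ) 4,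
      ‖(X τ).1 - τ * (collisionSpeed μ * Complex.I)‖ ≤ 1 / 1000 * τ := by
    intro τ hτ
    have hd : ∀ s ∈ Set.Icc (0 : ℝ) 4, HasDerivWithinAt
        (fun s : ℝ => (X s).1 - s * (collisionSpeed μ * Complex.I))
        ((X s).2.1 - 1 * (collisionSpeed μ * Complex.I)) (Set.Icc 0 4) s := by
      intro s hs
      have h1 := (hX s).fst_component
      have h2 : (regularizedField μ (truncateState (X s))).1 = (X s).2.1 := by
        rw [regularizedField, truncateState]
        exact radialRetract_of_le (by norm_num) ((hvb s hs).trans (by norm_num))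
      rw [h2] at h1
      exact (h1.sub ((hasDerivAt_id' s).ofReal_comp.mul_const _)).hasDerivWithinAt
    have h1 := norm_image_sub_le_of_norm_deriv_le_segment' hd
      (fun s hs => by rw [one_mul]; exact hv s ⟨hs.1, hs.2.le⟩) τ hτ
    simpa [h0, collisionState] using h1
  refine ⟨h0, fun τ hτ => ?_, hv, hw⟩
  have hwb : ‖(X τ).1‖ ≤ 4 := by
    have h1 := norm_le_norm_add_norm_sub (τ * (collisionSpeed μ * Complex.I) : ℂ) (X τ).1
    rw [norm_sub_rev, norm_mul, Complex.norm_real, Real.norm_of_nonneg hτ.1] at h1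
    have := hτ.2
    have := hw τ hτ
    nlinarith [norm_nonneg (collisionSpeed μ * Complex.I : ℂ)]
  have htr : truncateState (X τ) = X τ := by
    rw [truncateState, radialRetract_of_le (by norm_num) hwb,
      radialRetract_of_le (by norm_num) ((hvb τ hτ).trans (by norm_num)),
      radialRetract_of_le one_pos ((hEb τ hτ).trans (by linarith))]
  have := hX τ
  rwa [htr] at this

end NearEstimates

section PhysicalVariables

variable {μ : ℝ}

lemma ham_rotating {u : ℂ} (hu : ‖u‖ = 1) (y V : ℂ) :
    Ham μ (u * y - μ).re (u * y - μ).im (u * V - Complex.I * μ).re (u * V - Complex.I * μ).im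
      = ‖V‖ ^ 2 / 2 - (conj y * V).im + μ * (u * y).re - μ ^ 2 / 2 - (1 - μ) / ‖y‖
        - μ / ‖u * y - 1‖ := by
  rw [Ham, dS_eq_norm, dJ_eq_norm]
  have hu2 : u.re ^ 2 + u.im ^ 2 = 1 := by rw [← nrm2_sq, nrm2_eq_norm, hu, one_pow]
  have hV : ‖V‖ ^ 2 = V.re ^ 2 + V.im ^ 2 := by rw [← nrm2_sq, nrm2_eq_norm]
  have e1 : u * y - μ + μ = u * y := by ring
  have e2 : u * y - μ - (1 - μ) = u * y - 1 := by ring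
  rw [e1, e2, norm_mul, hu, one_mul, hV]
  simp
  linear_combination ((V.re ^ 2 + V.im ^ 2) / 2 - (y.re * V.im - y.im * V.re)) * hu2

lemma angularMomentum_rotating {u : ℂ} (hu : ‖u‖ = 1) (y V : ℂ) :
    angularMomentum (u * y - μ, u * V - Complex.I * μ)
      = (conj y * V).im - μ * (u * y).re - μ * (u * V).im + μ ^ 2 := by
  have hu2 : u.re ^ 2 + u.im ^ 2 = 1 := by rw [← nrm2_sq, nrm2_eq_norm, hu, one_pow]
  rw [angularMomentum]
  simp
  linear_combination (y.re * V.im - y.im * V.re) * hu2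

lemma outflow_rotating {u : ℂ} (hu : ‖u‖ = 1) (y V : ℂ) :
    outflow (u * y - μ, u * V - Complex.I * μ)
      = (conj y * V).re - μ * (u * V).re - μ * (u * y).im := by
  have hu2 : u.re ^ 2 + u.im ^ 2 = 1 := by rw [← nrm2_sq, nrm2_eq_norm, hu, one_pow]
  rw [outflow]
  simp
  linear_combination (y.re * V.re + y.im * V.im) * hu2

lemma outflow_le_norm_mul (X : ℂ × ℂ) : outflow X ≤ ‖X.1‖ * ‖X.2‖ := by
  have h := Complex.re_le_norm (conj X.1 * X.2)
  rw [norm_mul, Complex.norm_conj] at h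
  refine le_trans (le_of_eq ?_) h
  simp [outflow]

/-- Position and momentum in the rotating frame of a state of the regularized system. -/
noncomputable def physicalState (μ : ℝ) (X : ℂ × ℂ × ℝ × ℝ) : ℂ × ℂ :=
  (Complex.exp ((-X.2.2.2 : ℝ) * Complex.I) * (X.1 * X.1) - μ,
    Complex.exp ((-X.2.2.2 : ℝ) * Complex.I) * (2 * X.2.1 / conj X.1) - Complex.I * μ)

end PhysicalVariables

lemma HasDerivAt.complex_conj {f : ℝ → ℂ} {f' : ℂ} {t : ℝ} (h : HasDerivAt f f' t) :
    HasDerivAt (fun s => conj (f s)) (conj f') t :=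
  (Complex.conjCLE.toContinuousLinearMap.hasFDerivAt (x := f t)).comp_hasDerivAt t h

namespace IsEjection

variable {μ h : ℝ} {X : ℝ → ℂ × ℂ × ℝ × ℝ}

lemma component_bounds (S : IsEjection μ h X) (hμ : 0 < μ) (hμ' : μ < 1 / 100000000) {τ : ℝ}
    (hτ : τ ∈ Set.Icc (0 : ℝ) 4) :
    |(X τ).1.re| ≤ 1 / 1000 * τ ∧ 699 / 1000 * τ ≤ (X τ).1.im ∧ (X τ).1.im ≤ 709 / 1000 * τ := by
  obtain ⟨ha1, ha2⟩ := collisionSpeed_bounds hμ hμ'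
  have h1 := (Complex.abs_re_le_norm _).trans (S.position τ hτ)
  have h2 := (Complex.abs_im_le_norm _).trans (S.position τ hτ)
  simp at h1 h2
  have h3 := abs_le.1 h2
  refine ⟨by linarith, ?_, ?_⟩ <;> nlinarith [hτ.1]

lemma velocity_bounds (S : IsEjection μ h X) (hμ : 0 < μ) (hμ' : μ < 1 / 100000000) {τ : ℝ}
    (hτ : τ ∈ Set.Icc (0 : ℝ) 4) :
    |(X τ).2.1.re| ≤ 1 / 1000 ∧ 699 / 1000 ≤ (X τ).2.1.im ∧ ‖(X τ).2.1‖ ≤ 71 / 100 := by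
  obtain ⟨ha1, ha2⟩ := collisionSpeed_bounds hμ hμ'
  have h1 := (Complex.abs_re_le_norm _).trans (S.velocity τ hτ)
  have h2 := (Complex.abs_im_le_norm _).trans (S.velocity τ hτ)
  simp at h1 h2
  have h3 := abs_le.1 h2
  refine ⟨by linarith, by linarith, ?_⟩
  have h4 := norm_le_norm_add_norm_sub (collisionSpeed μ * Complex.I : ℂ) (X τ).2.1
  rw [norm_sub_rev, norm_mul, Complex.norm_I, mul_one, Complex.norm_real,
    Real.norm_of_nonneg (by linarith)] at h4
  linarith [S.velocity τ hτ]

lemma normSq_bounds (S : IsEjection μ h X) (hμ : 0 < μ) (hμ' : μ < 1 / 100000000) {τ : ℝ}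
    (hτ : τ ∈ Set.Icc (0 : ℝ) 4) :
    488 / 1000 * τ ^ 2 ≤ ‖(X τ).1‖ ^ 2 ∧ ‖(X τ).1‖ ^ 2 ≤ 503 / 1000 * τ ^ 2 := by
  obtain ⟨h1, h2, h3⟩ := S.component_bounds hμ hμ' hτ
  rw [← nrm2_eq_norm, nrm2_sq, ← sq_abs (X τ).1.re]
  have := abs_nonneg (X τ).1.re
  have := hτ.1
  constructor <;> nlinarith

lemma norm_bounds (S : IsEjection μ h X) (hμ : 0 < μ) (hμ' : μ < 1 / 100000000) {τ : ℝ}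
    (hτ : τ ∈ Set.Icc (0 : ℝ) 4) : 697 / 1000 * τ ≤ ‖(X τ).1‖ ∧ ‖(X τ).1‖ ≤ 71 / 100 * τ := by
  obtain ⟨h1, h2⟩ := S.normSq_bounds hμ hμ' hτ
  have := hτ.1
  constructor
  · exact le_of_sq_le_sq (by nlinarith) (norm_nonneg _)
  · exact le_of_sq_le_sq (by nlinarith) (by positivity)

lemma position_ne_zero (S : IsEjection μ h X) (hμ : 0 < μ) (hμ' : μ < 1 / 100000000) {τ : ℝ}
    (hτ : τ ∈ Set.Ioc (0 : ℝ) 4) : (X τ).1 ≠ 0 := by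
  have := (S.norm_bounds hμ hμ' ⟨hτ.1.le, hτ.2⟩).1
  have := hτ.1
  exact norm_pos_iff.1 (by linarith)

lemma hasDerivAt_time (S : IsEjection μ h X) {τ : ℝ} (hτ : τ ∈ Set.Icc (0 : ℝ) 4) :
    HasDerivAt (fun s => (X s).2.2.2) (‖(X τ).1‖ ^ 2) τ := by
  have := (S.hasDerivAt τ hτ).snd_component.snd_component.snd_component
  refine this.congr_deriv ?_
  rw [regularizedField]
  dsimp only
  rw [Complex.mul_conj, Complex.ofReal_re, Complex.normSq_eq_norm_sq]

lemma time_zero (S : IsEjection μ h X) : (X 0).2.2.2 = 0 := by rw [S.zero, collisionState]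

lemma strictMonoOn_time (S : IsEjection μ h X) (hμ : 0 < μ) (hμ' : μ < 1 / 100000000) :
    StrictMonoOn (fun s => (X s).2.2.2) (Set.Icc 0 4) := by
  refine strictMonoOn_of_deriv_pos (convex_Icc 0 4)
    (fun s hs => (S.hasDerivAt_time hs).continuousAt.continuousWithinAt) (fun s hs => ?_)
  rw [interior_Icc] at hs
  rw [(S.hasDerivAt_time ⟨hs.1.le, hs.2.le⟩).deriv]
  have := norm_pos_iff.2 (S.position_ne_zero hμ hμ' ⟨hs.1, hs.2.le⟩)
  positivity

lemma time_nonneg (S : IsEjection μ h X) (hμ : 0 < μ) (hμ' : μ < 1 / 100000000) {τ : ℝ}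
    (hτ : τ ∈ Set.Icc (0 : ℝ) 4) : 0 ≤ (X τ).2.2.2 := by
  rw [← S.time_zero]
  exact (S.strictMonoOn_time hμ hμ').monotoneOn ⟨le_rfl, by norm_num⟩ hτ hτ.1

lemma time_le (S : IsEjection μ h X) (hμ : 0 < μ) (hμ' : μ < 1 / 100000000) {τ : ℝ}
    (hτ : τ ∈ Set.Icc (0 : ℝ) 4) : (X τ).2.2.2 ≤ 168 / 1000 * τ ^ 3 := by
  have hder : ∀ s ∈ Set.Icc (0 : ℝ) 4, HasDerivAt (fun s => (X s).2.2.2 - 168 / 1000 * s ^ 3)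
      (‖(X s).1‖ ^ 2 - 168 / 1000 * ((3 : ℕ) * s ^ (3 - 1))) s := fun s hs =>
    (S.hasDerivAt_time hs).sub ((hasDerivAt_pow 3 s).const_mul _)
  have hanti : AntitoneOn (fun s => (X s).2.2.2 - 168 / 1000 * s ^ 3) (Set.Icc 0 4) := by
    refine antitoneOn_of_deriv_nonpos (convex_Icc 0 4)
      (fun s hs => (hder s hs).continuousAt.continuousWithinAt)
      (fun s hs => (hder s (interior_subset hs)).differentiableAt.differentiableWithinAt)
      (fun s hs => ?_)
    rw [(hder s (interior_subset hs)).deriv]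
    have := (S.normSq_bounds hμ hμ' (interior_subset hs)).2
    norm_num
    nlinarith [sq_nonneg s]
  have := hanti ⟨le_rfl, by norm_num⟩ hτ hτ.1
  simp only [S.time_zero] at this
  linarith

/-- The ejected body stays away from the second primary. -/
lemma half_le_norm_sub (S : IsEjection μ h X) (hμ : 0 < μ) (hμ' : μ < 1 / 100000000) {τ : ℝ}
    (hτ : τ ∈ Set.Icc (0 : ℝ) 4) :
    1 / 2 ≤ ‖(X τ).1 * (X τ).1 - Complex.exp ((X τ).2.2.2 * Complex.I)‖ := by
  set t := (X τ).2.2.2 with ht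
  obtain ⟨hn1, hn2⟩ := S.normSq_bounds hμ hμ' hτ
  by_cases hbig : 3 / 2 ≤ ‖(X τ).1‖ ^ 2
  · have h1 := norm_sub_norm_le ((X τ).1 * (X τ).1) (Complex.exp (t * Complex.I))
    rw [Complex.norm_exp_ofReal_mul_I, norm_mul] at h1
    nlinarith
  · push Not at hbig
    obtain ⟨hx, hy1, hy2⟩ := S.component_bounds hμ hμ' hτ
    have hτ2 : τ ≤ 9 / 5 := by nlinarith [hτ.1]
    have ht0 : 0 ≤ t := S.time_nonneg hμ hμ' hτ
    have ht1 : t ≤ 1 := by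
      refine (S.time_le hμ hμ' hτ).trans ?_
      have : τ ^ 3 ≤ (9 / 5) ^ 3 := pow_le_pow_left₀ hτ.1 hτ2 3
      linarith
    have hcos : 0 ≤ Real.cos t :=
      Real.cos_nonneg_of_neg_pi_div_two_le_of_le (by linarith [Real.pi_pos])
        (by linarith [Real.pi_gt_three])
    have hx' := abs_le.1 hx
    have hre : ((X τ).1 * (X τ).1).re ≤ 0 := by
      rw [Complex.mul_re]
      nlinarith [hτ.1]
    have him : |((X τ).1 * (X τ).1).im| ≤ 1 / 10 := by
      rw [Complex.mul_im, abs_le]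
      have hp : |(X τ).1.re * (X τ).1.im| ≤ 1 / 20 := by
        rw [abs_mul, abs_of_nonneg (by linarith [hτ.1] : 0 ≤ (X τ).1.im)]
        have : |(X τ).1.re| * (X τ).1.im ≤ (1 / 1000 * τ) * (709 / 1000 * τ) := by
          gcongr <;> linarith [hτ.1]
        nlinarith [hτ.1]
      have := abs_le.1 hp
      constructor <;> linarith
    generalize (X τ).1 * (X τ).1 = y at *
    have e : ‖y - Complex.exp (t * Complex.I)‖ ^ 2
        = (y.re - Real.cos t) ^ 2 + (y.im - Real.sin t) ^ 2 := by
      rw [← nrm2_eq_norm, nrm2_sq, Complex.sub_re, Complex.sub_im, Complex.exp_ofReal_mul_I_re,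
        Complex.exp_ofReal_mul_I_im]
    refine le_of_sq_le_sq ?_ (norm_nonneg _)
    rw [e]
    have h1 := Real.sin_sq_add_cos_sq t
    have h2 : |y.im * Real.sin t| ≤ 1 / 10 := by
      rw [abs_mul]
      have := Real.abs_sin_le_one t
      nlinarith [abs_nonneg y.im, abs_nonneg (Real.sin t)]
    have h3 := abs_le.1 h2
    nlinarith [sq_nonneg y.re, sq_nonneg y.im, mul_nonneg (neg_nonneg.2 hre) hcos]

/-- Definition of the Kepler energy, as a relation preserved by the regularized equations. -/
lemma energy_relation (S : IsEjection μ h X) (hμ' : μ < 1) {τ : ℝ}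
    (hτ : τ ∈ Set.Icc (0 : ℝ) 4) :
    (X τ).2.2.1 * ((X τ).1 * conj (X τ).1) = 2 * ((X τ).2.1 * conj (X τ).2.1) - (1 - μ) := by
  have hder : ∀ s ∈ Set.Icc (0 : ℝ) 4, HasDerivAt (fun s => ((X s).2.2.1 : ℂ)
      * ((X s).1 * conj (X s).1) - 2 * ((X s).2.1 * conj (X s).2.1)) 0 s := by
    intro s hs
    have hX := S.hasDerivAt s hs
    have hw := hX.fst_component
    have hv := hX.snd_component.fst_component
    have hE := hX.snd_component.snd_component.fst_component
    have := (hE.ofReal_comp.fun_mul (hw.fun_mul hw.complex_conj)).fun_sub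
      ((hv.fun_mul hv.complex_conj).const_mul (2 : ℂ))
    refine this.congr_deriv ?_
    simp only [regularizedField]
    generalize perturbation ((X s).1 * (X s).1) (X s).2.2.2 = g
    have htwo : conj (2 : ℂ) = 2 := Complex.conj_ofNat 2
    rw [Complex.ofReal_mul, Complex.re_eq_add_conj]
    simp [htwo]
    ring
  have hconst := constant_of_has_deriv_right_zero
    (fun s hs => (hder s hs).continuousAt.continuousWithinAt)
    (fun s hs => (hder s ⟨hs.1, hs.2.le⟩).hasDerivWithinAt) τ hτ
  simp only [S.zero, collisionState] at hconst
  have ha : (collisionSpeed μ : ℂ) ^ 2 = (1 - μ) / 2 := by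
    rw [← Complex.ofReal_pow, collisionSpeed_sq hμ']
    push_cast
    ring
  simp at hconst
  linear_combination hconst - 2 * ha + 2 * (collisionSpeed μ : ℂ) ^ 2 * Complex.I_sq

end IsEjection

lemma norm_exp_neg_ofReal_mul_I (t : ℝ) : ‖Complex.exp ((-t : ℝ) * Complex.I)‖ = 1 :=
  Complex.norm_exp_ofReal_mul_I _

lemma exp_neg_mul_exp (t : ℝ) :
    Complex.exp ((-t : ℝ) * Complex.I) * Complex.exp (t * Complex.I) = 1 := by
  rw [← Complex.exp_add]
  simp

namespace IsEjection

variable {μ h : ℝ} {X : ℝ → ℂ × ℂ × ℝ × ℝ}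

lemma hasDerivAt_rotation (S : IsEjection μ h X) {τ : ℝ} (hτ : τ ∈ Set.Icc (0 : ℝ) 4) :
    HasDerivAt (fun s => Complex.exp ((-(X s).2.2.2 : ℝ) * Complex.I))
      (Complex.exp ((-(X τ).2.2.2 : ℝ) * Complex.I) * (-(‖(X τ).1‖ ^ 2 : ℝ) * Complex.I)) τ := by
  have := ((S.hasDerivAt_time hτ).fun_neg.ofReal_comp.mul_const Complex.I).cexp
  simpa using this

lemma hasDerivAt_position (S : IsEjection μ h X) (hμ : 0 < μ) (hμ' : μ < 1 / 100000000) {τ : ℝ}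
    (hτ : τ ∈ Set.Ioc (0 : ℝ) 4) :
    HasDerivAt (fun s => (physicalState μ (X s)).1)
      (‖(X τ).1‖ ^ 2 • ((physicalState μ (X τ)).2 - Complex.I * (physicalState μ (X τ)).1)) τ := by
  have hτ' : τ ∈ Set.Icc (0 : ℝ) 4 := ⟨hτ.1.le, hτ.2⟩
  have hw := (S.hasDerivAt τ hτ').fst_component
  have hw0 := S.position_ne_zero hμ hμ' hτ
  have hwb0 : conj (X τ).1 ≠ 0 := by simpa using hw0
  refine (((S.hasDerivAt_rotation hτ').fun_mul (hw.fun_mul hw)).sub_const _).congr_deriv ?_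
  have hn : ((‖(X τ).1‖ ^ 2 : ℝ) : ℂ) = (X τ).1 * conj (X τ).1 := by
    rw [Complex.mul_conj, Complex.normSq_eq_norm_sq]
  rw [Complex.real_smul, hn, physicalState, regularizedField]
  dsimp only
  generalize conj (X τ).1 = wb at *
  field_simp
  ring

lemma hasDerivAt_momentum (S : IsEjection μ h X) (hμ : 0 < μ) (hμ' : μ < 1 / 100000000) {τ : ℝ}
    (hτ : τ ∈ Set.Ioc (0 : ℝ) 4) :
    HasDerivAt (fun s => (physicalState μ (X s)).2)
      (‖(X τ).1‖ ^ 2 • momentumField μ (physicalState μ (X τ)).1 (physicalState μ (X τ)).2) τ := by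
  have hτ' : τ ∈ Set.Icc (0 : ℝ) 4 := ⟨hτ.1.le, hτ.2⟩
  have hw := (S.hasDerivAt τ hτ').fst_component
  have hv := (S.hasDerivAt τ hτ').snd_component.fst_component
  have hw0 := S.position_ne_zero hμ hμ' hτ
  have hwb0 : conj (X τ).1 ≠ 0 := by simpa using hw0
  refine (((S.hasDerivAt_rotation hτ').fun_mul
    ((hv.const_mul (2 : ℂ)).fun_div hw.complex_conj hwb0)).sub_const _).congr_deriv ?_
  have hn : ((‖(X τ).1‖ ^ 2 : ℝ) : ℂ) = (X τ).1 * conj (X τ).1 := by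
    rw [Complex.mul_conj, Complex.normSq_eq_norm_sq]
  have he := S.energy_relation (by linarith) hτ'
  have hD := S.half_le_norm_sub hμ hμ' hτ'
  have hu := norm_exp_neg_ofReal_mul_I (X τ).2.2.2
  have hue := exp_neg_mul_exp (X τ).2.2.2
  have e1 : (physicalState μ (X τ)).1 + μ
      = Complex.exp ((-(X τ).2.2.2 : ℝ) * Complex.I) * ((X τ).1 * (X τ).1) := by
    rw [physicalState]; ring
  have e2 : (physicalState μ (X τ)).1 - (1 - μ)
      = Complex.exp ((-(X τ).2.2.2 : ℝ) * Complex.I)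
        * ((X τ).1 * (X τ).1 - Complex.exp ((X τ).2.2.2 * Complex.I)) := by
    rw [physicalState, mul_sub, hue]; ring
  rw [Complex.real_smul, momentumField, e1, e2, norm_mul, norm_mul, norm_mul, hu, one_mul, one_mul,
    regularizedField]
  dsimp only
  rw [perturbation, softKernel_of_le hD, Complex.real_smul, Complex.real_smul, Complex.real_smul]
  have hnn : ((((‖(X τ).1‖ * ‖(X τ).1‖) ^ 3)⁻¹ : ℝ) : ℂ) = (((X τ).1 * conj (X τ).1) ^ 3)⁻¹ := by
    rw [← hn]; push_cast; ring
  rw [hnn, hn, physicalState]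
  dsimp only
  generalize
    (((‖(X τ).1 * (X τ).1 - Complex.exp ((X τ).2.2.2 * Complex.I)‖ ^ 3)⁻¹ : ℝ) : ℂ) = d at *
  generalize conj (X τ).1 = wb at *
  generalize conj (X τ).2.1 = vb at *
  generalize (X τ).2.1 = v at *
  generalize Complex.exp ((X τ).2.2.2 * Complex.I) = e at *
  generalize Complex.exp ((-(X τ).2.2.2 : ℝ) * Complex.I) = u at *
  generalize (X τ).1 = w at *
  have hE : ((X τ).2.2.1 : ℂ) = (2 * (v * vb) - (1 - μ)) / (w * wb) := by
    field_simp
    linear_combination he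
  rw [hE]
  field_simp
  linear_combination (-μ*w*wb^3 ) * hue + (-μ*w*wb^3 ) * Complex.I_sq

end IsEjection

namespace IsEjection

variable {μ h : ℝ} {X : ℝ → ℂ × ℂ × ℝ × ℝ}

lemma norm_position_add (μ : ℝ) (X : ℂ × ℂ × ℝ × ℝ) :
    ‖(physicalState μ X).1 + μ‖ = ‖X.1‖ ^ 2 := by
  rw [physicalState, sub_add_cancel, norm_mul, norm_exp_neg_ofReal_mul_I, norm_mul]
  ring

lemma norm_position_sub (μ : ℝ) (X : ℂ × ℂ × ℝ × ℝ) :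
    ‖(physicalState μ X).1 - (1 - μ)‖ = ‖X.1 * X.1 - Complex.exp (X.2.2.2 * Complex.I)‖ := by
  have e : (physicalState μ X).1 - (1 - μ) = Complex.exp ((-X.2.2.2 : ℝ) * Complex.I)
      * (X.1 * X.1 - Complex.exp (X.2.2.2 * Complex.I)) := by
    rw [physicalState, mul_sub, exp_neg_mul_exp]; ring
  rw [e, norm_mul, norm_exp_neg_ofReal_mul_I, one_mul]

/-- The Hamiltonian in regularized variables. -/
noncomputable def regularizedHam (μ : ℝ) (X : ℂ × ℂ × ℝ × ℝ) : ℝ :=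
  X.2.2.1 - 2 * (conj X.1 * X.2.1).im
    + μ * (Complex.exp ((-X.2.2.2 : ℝ) * Complex.I) * (X.1 * X.1)).re - μ ^ 2 / 2
    - μ / ‖X.1 * X.1 - Complex.exp (X.2.2.2 * Complex.I)‖

lemma conj_sq_mul_div {w v : ℂ} (hw : w ≠ 0) :
    conj (w * w) * (2 * v / conj w) = 2 * (conj w * v) := by
  have hwb0 : conj w ≠ 0 := by simpa using hw
  rw [map_mul]
  field_simp

lemma ham_physicalState (S : IsEjection μ h X) (hμ : 0 < μ) (hμ' : μ < 1 / 100000000) {τ : ℝ}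
    (hτ : τ ∈ Set.Ioc (0 : ℝ) 4) :
    Ham μ (physicalState μ (X τ)).1.re (physicalState μ (X τ)).1.im (physicalState μ (X τ)).2.re
      (physicalState μ (X τ)).2.im = regularizedHam μ (X τ) := by
  have hw0 := S.position_ne_zero hμ hμ' hτ
  have he := S.energy_relation (by linarith) ⟨hτ.1.le, hτ.2⟩
  have hsub := norm_position_sub μ (X τ)
  rw [Complex.mul_conj, Complex.mul_conj, Complex.normSq_eq_norm_sq,
    Complex.normSq_eq_norm_sq] at he
  norm_cast at he
  rw [physicalState, ham_rotating (norm_exp_neg_ofReal_mul_I _), conj_sq_mul_div hw0,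
    regularizedHam, ← hsub, physicalState]
  have e : Complex.exp ((-(X τ).2.2.2 : ℝ) * Complex.I) * ((X τ).1 * (X τ).1) - μ - (1 - μ)
      = Complex.exp ((-(X τ).2.2.2 : ℝ) * Complex.I) * ((X τ).1 * (X τ).1) - 1 := by ring
  dsimp only
  rw [e, norm_div, norm_mul, norm_mul, Complex.norm_conj]
  have hn := norm_pos_iff.2 hw0
  have e2 : (2 * (conj (X τ).1 * (X τ).2.1)).im = 2 * (conj (X τ).1 * (X τ).2.1).im := by
    simp [mul_add]
  have hE : (X τ).2.2.1 = (2 * ‖(X τ).2.1‖ ^ 2 - (1 - μ)) / ‖(X τ).1‖ ^ 2 := by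
    rw [eq_div_iff (by positivity)]
    exact_mod_cast he
  rw [e2, hE]
  have htwo : ‖(2 : ℂ)‖ = 2 := by simp
  rw [htwo]
  field_simp
  ring

lemma continuousAt_regularizedHam (S : IsEjection μ h X) (hμ : 0 < μ) (hμ' : μ < 1 / 100000000)
    {τ : ℝ} (hτ : τ ∈ Set.Icc (0 : ℝ) 4) : ContinuousAt (fun s => regularizedHam μ (X s)) τ := by
  have hX := (S.hasDerivAt τ hτ).continuousAt
  have hc : ContinuousAt (regularizedHam μ) (X τ) := by
    have hD : ‖(X τ).1 * (X τ).1 - Complex.exp ((X τ).2.2.2 * Complex.I)‖ ≠ 0 := by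
      linarith [S.half_le_norm_sub hμ hμ' hτ]
    unfold regularizedHam
    refine ContinuousAt.sub (Continuous.continuousAt ?_)
      (ContinuousAt.div continuousAt_const (Continuous.continuousAt ?_) hD)
    · have := Complex.continuous_re
      have := Complex.continuous_im
      have := Complex.continuous_conj
      fun_prop
    · fun_prop
  exact hc.comp hX

lemma regularizedHam_zero (S : IsEjection μ h X) : regularizedHam μ (X 0) = h := by
  rw [S.zero]
  simp [regularizedHam, collisionState, collisionEnergy]

/-- Angular momentum about the first primary grows slowly. -/
lemma abs_im_conj_mul_le (S : IsEjection μ h X) (hμ : 0 < μ) (hμ' : μ < 1 / 100000000) {τ : ℝ}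
    (hτ : τ ∈ Set.Icc (0 : ℝ) 3) : |(conj (X τ).1 * (X τ).2.1).im| ≤ 640 * μ * τ := by
  have hder : ∀ s ∈ Set.Icc (0 : ℝ) 3, HasDerivWithinAt (fun s => (conj (X s).1 * (X s).2.1).im)
      (conj (X s).1 * (μ / 2 * ((X s).1 * conj (X s).1 * conj (X s).1
        * perturbation ((X s).1 * (X s).1) (X s).2.2.2))).im (Set.Icc 0 3) s := by
    intro s hs
    have hX := S.hasDerivAt s ⟨hs.1, hs.2.trans (by norm_num)⟩
    have := (hX.fst_component.complex_conj.fun_mul hX.snd_component.fst_component).complex_im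
    refine (this.congr_deriv ?_).hasDerivWithinAt
    rw [regularizedField]
    dsimp only
    rw [mul_add, mul_comm (conj (X s).2.1), Complex.mul_conj, ← add_assoc, Complex.add_im]
    have : (((Complex.normSq (X s).2.1 : ℝ) : ℂ)
        + conj (X s).1 * ((X s).2.2.1 * (X s).1 * (1 / 2))).im = 0 := by
      simp
      ring
    rw [this, zero_add]
  have hbound : ∀ s ∈ Set.Icc (0 : ℝ) 3, ‖(conj (X s).1 * (μ / 2 * ((X s).1 * conj (X s).1
      * conj (X s).1 * perturbation ((X s).1 * (X s).1) (X s).2.2.2))).im‖ ≤ 640 * μ := by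
    intro s hs
    refine (Complex.abs_im_le_norm _).trans ?_
    simp only [norm_mul, norm_div, Complex.norm_conj, Complex.norm_real]
    rw [Real.norm_of_nonneg hμ.le]
    have hw := (S.norm_bounds hμ hμ' ⟨hs.1, hs.2.trans (by norm_num)⟩).2
    have hw4 : ‖(X s).1‖ ≤ 4 := by linarith [hs.2]
    have hg := norm_perturbation_le ((X s).1 * (X s).1) (X s).2.2.2
    have htwo : ‖(2 : ℂ)‖ = 2 := by simp
    rw [htwo]
    calc ‖(X s).1‖ * (μ / 2 * (‖(X s).1‖ * ‖(X s).1‖ * ‖(X s).1‖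
          * ‖perturbation ((X s).1 * (X s).1) (X s).2.2.2‖))
        ≤ 4 * (μ / 2 * (4 * 4 * 4 * 5)) := by gcongr
      _ = 640 * μ := by ring
  have := (convex_Icc (0 : ℝ) 3).norm_image_sub_le_of_norm_hasDerivWithin_le hder hbound
    ⟨le_rfl, by norm_num⟩ hτ
  simpa [S.zero, collisionState, abs_of_nonneg hτ.1] using this

end IsEjection

/-- Inverse function of a strictly increasing differentiable function on an interval. -/
lemma StrictMonoOn.exists_inverse {f f' : ℝ → ℝ} {a b : ℝ} (hab : a < b)
    (hmono : StrictMonoOn f (Set.Icc a b)) (hder : ∀ s ∈ Set.Icc a b, HasDerivAt f (f' s) s)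
    (hne : ∀ s ∈ Set.Ioo a b, f' s ≠ 0) :
    ∃ σ : ℝ → ℝ, (∀ s ∈ Set.Icc a b, σ (f s) = s) ∧
      (∀ t ∈ Set.Ioo (f a) (f b), σ t ∈ Set.Ioo a b ∧ HasDerivAt σ (f' (σ t))⁻¹ t) ∧
      Tendsto σ (𝓝[>] (f a)) (𝓝[>] a) := by
  have ha : a ∈ Set.Icc a b := ⟨le_rfl, hab.le⟩
  have hb : b ∈ Set.Icc a b := ⟨hab.le, le_rfl⟩
  have hcont : ContinuousOn f (Set.Icc a b) :=
    fun s hs => (hder s hs).continuousAt.continuousWithinAt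
  have himage := hcont.image_Icc_of_monotoneOn hab.le hmono.monotoneOn
  set σ := Function.invFunOn f (Set.Icc a b) with hσ
  have hleft : ∀ s ∈ Set.Icc a b, σ (f s) = s := fun s hs => hmono.injOn.leftInvOn_invFunOn hs
  have hright : ∀ t ∈ Set.Icc (f a) (f b), σ t ∈ Set.Icc a b ∧ f (σ t) = t := by
    intro t ht
    rw [← himage] at ht
    exact ⟨Function.invFunOn_mem ht, Function.invFunOn_eq ht⟩
  have hσmono : StrictMonoOn σ (Set.Icc (f a) (f b)) := by
    intro t ht t' ht' htt
    rw [← hmono.lt_iff_lt (hright t ht).1 (hright t' ht').1, (hright t ht).2, (hright t' ht').2]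
    exact htt
  have hσimage : σ '' Set.Icc (f a) (f b) = Set.Icc a b := by
    ext s
    constructor
    · rintro ⟨t, ht, rfl⟩
      exact (hright t ht).1
    · intro hs
      exact ⟨f s, himage ▸ Set.mem_image_of_mem f hs, hleft s hs⟩
  have hfab : f a < f b := hmono ha hb hab
  have hinterior : ∀ t ∈ Set.Ioo (f a) (f b), σ t ∈ Set.Ioo a b := by
    intro t ht
    have h1 := hσmono ⟨le_rfl, hfab.le⟩ ⟨ht.1.le, ht.2.le⟩ ht.1
    have h2 := hσmono ⟨ht.1.le, ht.2.le⟩ ⟨hfab.le, le_rfl⟩ ht.2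
    rw [hleft a ha] at h1
    rw [hleft b hb] at h2
    exact ⟨h1, h2⟩
  refine ⟨σ, hleft, fun t ht => ⟨hinterior t ht, ?_⟩, ?_⟩
  · have hσt := hinterior t ht
    have hc : ContinuousAt σ t := hσmono.continuousAt_of_image_mem_nhds
      (Icc_mem_nhds ht.1 ht.2) (hσimage ▸ Icc_mem_nhds hσt.1 hσt.2)
    refine (hder _ (Set.Ioo_subset_Icc_self hσt)).of_local_left_inverse hc (hne _ hσt) ?_
    filter_upwards [Icc_mem_nhds ht.1 ht.2] with y hy using (hright y hy).2
  · have hc : ContinuousWithinAt σ (Set.Ici (f a)) (f a) :=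
      hσmono.continuousWithinAt_right_of_image_mem_nhdsWithin (Icc_mem_nhdsGE hfab)
        (by rw [hσimage, hleft a ha]; exact Icc_mem_nhdsGE hab)
    have hc' := hc.mono Set.Ioi_subset_Ici_self
    rw [ContinuousWithinAt, hleft a ha] at hc'
    refine tendsto_nhdsWithin_iff.2 ⟨hc', ?_⟩
    filter_upwards [Ioo_mem_nhdsGT hfab] with t ht using (hinterior t ht).1

/-- The Hamiltonian at a state in complex notation. -/
noncomputable def complexHam (μ : ℝ) (X : ℂ × ℂ) : ℝ := Ham μ X.1.re X.1.im X.2.re X.2.im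

namespace IsEjection

variable {μ h : ℝ} {X : ℝ → ℂ × ℂ × ℝ × ℝ}

/-- The ejection orbit in the rotating frame and in physical time. -/
lemma exists_physical (S : IsEjection μ h X) (hμ : 0 < μ) (hμ' : μ < 1 / 100000000) :
    ∃ (Q : ℝ → ℂ × ℂ) (t₀ T : ℝ), 0 < t₀ ∧ t₀ < T ∧ Q t₀ = physicalState μ (X 3) ∧
      (∀ t ∈ Set.Ioo 0 T, SolvesAt μ Q t ∧ complexHam μ (Q t) = h) ∧
      Tendsto (fun t => (Q t).1) (𝓝[>] 0) (𝓝 (-μ)) := by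
  obtain ⟨σ, hleft, hσ, hlim⟩ := (S.strictMonoOn_time hμ hμ').exists_inverse (by norm_num)
    (fun s hs => S.hasDerivAt_time hs) (fun s hs => by
      have := norm_pos_iff.2 (S.position_ne_zero hμ hμ' ⟨hs.1, hs.2.le⟩)
      positivity)
  have hT0 : (X 0).2.2.2 = 0 := S.time_zero
  simp only [hT0] at hσ hlim
  have h03 := S.strictMonoOn_time hμ hμ' (a := 0) (b := 3) (by norm_num) (by norm_num) (by norm_num)
  have h34 := S.strictMonoOn_time hμ hμ' (a := 3) (b := 4) (by norm_num) (by norm_num) (by norm_num)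
  simp only [hT0] at h03 h34
  have hsolves : ∀ t ∈ Set.Ioo 0 (X 4).2.2.2,
      SolvesAt μ (fun t => physicalState μ (X (σ t))) t := by
    intro t ht
    obtain ⟨hσt, hd⟩ := hσ t ht
    have hσt' : σ t ∈ Set.Ioc (0 : ℝ) 4 := ⟨hσt.1, hσt.2.le⟩
    have hw := norm_pos_iff.2 (S.position_ne_zero hμ hμ' hσt')
    refine ⟨?_, ?_, ?_, ?_⟩
    · rw [← norm_pos_iff, norm_position_add]
      positivity
    · rw [← norm_pos_iff, norm_position_sub]
      linarith [S.half_le_norm_sub hμ hμ' ⟨hσt.1.le, hσt.2.le⟩]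
    · refine ((S.hasDerivAt_position hμ hμ' hσt').scomp t hd).congr_deriv ?_
      rw [smul_smul, inv_mul_cancel₀ (by positivity), one_smul]
    · refine ((S.hasDerivAt_momentum hμ hμ' hσt').scomp t hd).congr_deriv ?_
      rw [smul_smul, inv_mul_cancel₀ (by positivity), one_smul]
  refine ⟨fun t => physicalState μ (X (σ t)), (X 3).2.2.2, (X 4).2.2.2, h03, h34, ?_,
    fun t ht => ⟨hsolves t ht, ?_⟩, ?_⟩
  · simp only [hleft 3 (by norm_num)]
  · have hreg : Tendsto (fun s => regularizedHam μ (X (σ s))) (𝓝[>] 0) (𝓝 h) := by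
      have hc := S.continuousAt_regularizedHam hμ hμ' (τ := 0) (by norm_num)
      rw [ContinuousAt, S.regularizedHam_zero] at hc
      exact hc.comp (hlim.mono_right nhdsWithin_le_nhds)
    refine tendsto_nhds_unique (tendsto_const_nhds.congr' ?_) hreg
    filter_upwards [Ioo_mem_nhdsGT ht.1] with s hs
    obtain ⟨hσs, -⟩ := hσ s ⟨hs.1, hs.2.trans ht.2⟩
    rw [← S.ham_physicalState hμ hμ' ⟨hσs.1, hσs.2.le⟩]
    exact (SolvesAt.isPCRTBPSol (I := Set.Icc s t) fun r hr =>
      hsolves r ⟨hs.1.trans_le hr.1, hr.2.trans_lt ht.2⟩).ham_eq ⟨hs.2.le, le_rfl⟩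
  · have hw : Tendsto (fun s => ‖(X s).1‖ ^ 2) (𝓝 0) (𝓝 0) := by
      have := (S.hasDerivAt 0 (by norm_num)).fst_component.continuousAt.norm.tendsto.pow 2
      simpa [S.zero, collisionState] using this
    have hq := hw.comp (hlim.mono_right nhdsWithin_le_nhds)
    rw [tendsto_iff_norm_sub_tendsto_zero]
    refine hq.congr fun t => ?_
    rw [sub_neg_eq_add, norm_position_add]
    rfl

lemma isFarStart (S : IsEjection μ h X) (hμ : 0 < μ) (hμ' : μ < 1 / 100000000) :
    IsFarStart μ h (3860 * μ) (physicalState μ (X 3)) := by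
  have h3 : (3 : ℝ) ∈ Set.Icc (0 : ℝ) 4 := by norm_num
  have hw0 := S.position_ne_zero hμ hμ' (τ := 3) (by norm_num)
  obtain ⟨hn1, hn2⟩ := S.norm_bounds hμ hμ' h3
  obtain ⟨hs1, hs2⟩ := S.normSq_bounds hμ hμ' h3
  obtain ⟨hx, hy, -⟩ := S.component_bounds hμ hμ' h3
  obtain ⟨hvx, hvy, hv⟩ := S.velocity_bounds hμ hμ' h3
  have ham := S.abs_im_conj_mul_le hμ hμ' (τ := 3) (by norm_num)
  have hu := norm_exp_neg_ofReal_mul_I (X 3).2.2.2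
  have hq : ‖(physicalState μ (X 3)).1 + μ‖ = ‖(X 3).1‖ ^ 2 := norm_position_add _ _
  have hq1 : ‖(X 3).1‖ ^ 2 - μ ≤ ‖(physicalState μ (X 3)).1‖ := by
    rw [← hq]
    have := norm_add_le (physicalState μ (X 3)).1 (μ : ℂ)
    rw [Complex.norm_real, Real.norm_of_nonneg hμ.le] at this
    linarith
  have hV : ‖2 * (X 3).2.1 / conj (X 3).1‖ ≤ 7 / 10 := by
    have htwo : ‖(2 : ℂ)‖ = 2 := by simp
    rw [norm_div, norm_mul, htwo, Complex.norm_conj, div_le_iff₀ (by linarith)]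
    linarith
  have hp : ‖(physicalState μ (X 3)).2‖ ≤ 1 := by
    rw [physicalState]
    refine (norm_sub_le _ _).trans ?_
    rw [norm_mul, hu, one_mul, norm_mul, Complex.norm_I, one_mul, Complex.norm_real,
      Real.norm_of_nonneg hμ.le]
    linarith
  have hcross : conj ((X 3).1 * (X 3).1) * (2 * (X 3).2.1 / conj (X 3).1)
    = 2 * (conj (X 3).1 * (X 3).2.1) := conj_sq_mul_div hw0
  have huy : ‖Complex.exp ((-(X 3).2.2.2 : ℝ) * Complex.I) * ((X 3).1 * (X 3).1)‖ ≤ 5 := by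
    rw [norm_mul, hu, one_mul, norm_mul, ← sq]
    linarith
  have huV : ‖Complex.exp ((-(X 3).2.2.2 : ℝ) * Complex.I) * (2 * (X 3).2.1 / conj (X 3).1)‖
      ≤ 5 := by
    rw [norm_mul, hu, one_mul]
    linarith
  have hμmul : ∀ a : ℝ, |a| ≤ 5 → |μ * a| ≤ 5 * μ := fun a ha => by
    rw [abs_mul, abs_of_pos hμ, mul_comm]
    gcongr
  have a1 := abs_le.1 (hμmul _ ((Complex.abs_re_le_norm _).trans huy))
  have a2 := abs_le.1 (hμmul _ ((Complex.abs_im_le_norm _).trans huy))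
  have a3 := abs_le.1 (hμmul _ ((Complex.abs_re_le_norm _).trans huV))
  have a4 := abs_le.1 (hμmul _ ((Complex.abs_im_le_norm _).trans huV))
  have two_re : ∀ z : ℂ, (2 * z).re = 2 * z.re := fun z => by simp
  have two_im : ∀ z : ℂ, (2 * z).im = 2 * z.im := fun z => by simp
  refine ⟨by linarith, ?_, ?_, ?_, ?_⟩
  · rw [physicalState, outflow_rotating hu, hcross, two_re]
    have hre : 1 ≤ (conj (X 3).1 * (X 3).2.1).re := by
      have hx' := abs_le.1 hx
      have hvx' := abs_le.1 hvx
      simp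
      nlinarith
    linarith
  · refine (outflow_le_norm_mul _).trans ?_
    exact mul_le_of_le_one_right (norm_nonneg _) hp
  · rw [physicalState, angularMomentum_rotating hu, hcross, two_im]
    have ham' := abs_le.1 ham
    rw [abs_le]
    constructor <;> nlinarith
  · obtain ⟨Q, t₀, T, h0, hT, hQ, hsol, -⟩ := S.exists_physical hμ hμ'
    rw [← hQ]
    exact (hsol t₀ ⟨h0, hT⟩).2

end IsEjection

section Gluing

variable {μ t₀ : ℝ} {Q R : ℝ → ℂ × ℂ}

lemma SolvesAt.congr_of_eventuallyEq {t : ℝ} (hQ : SolvesAt μ Q t) (h : R =ᶠ[𝓝 t] Q) :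
    SolvesAt μ R t := by
  have ht : R t = Q t := h.eq_of_nhds
  refine ⟨ht ▸ hQ.add_ne, ht ▸ hQ.sub_ne, ?_, ?_⟩
  · rw [ht]
    exact hQ.position.congr_of_eventuallyEq (h.fun_comp Prod.fst)
  · rw [ht]
    exact hQ.momentum.congr_of_eventuallyEq (h.fun_comp Prod.snd)

lemma SolvesAt.comp_sub_const {t : ℝ} (hQ : SolvesAt μ Q (t - t₀)) :
    SolvesAt μ (fun s => Q (s - t₀)) t :=
  ⟨hQ.add_ne, hQ.sub_ne, hQ.position.comp_sub_const t t₀, hQ.momentum.comp_sub_const t t₀⟩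

/-- The curve that follows `Q` until the time `t₀` and `R` afterwards. -/
noncomputable def glue (t₀ : ℝ) (Q R : ℝ → ℂ × ℂ) (t : ℝ) : ℂ × ℂ := if t ≤ t₀ then Q t else R t

lemma glue_of_le {t : ℝ} (ht : t ≤ t₀) : glue t₀ Q R t = Q t := if_pos ht

lemma glue_of_ge (h : Q t₀ = R t₀) {t : ℝ} (ht : t₀ ≤ t) : glue t₀ Q R t = R t := by
  rcases ht.eq_or_lt with rfl | ht
  · rw [glue_of_le le_rfl, h]
  · exact if_neg ht.not_ge

lemma HasDerivAt.of_eqOn_halfLines {E : Type*} [NormedAddCommGroup E] [NormedSpace ℝ E]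
    {f g k : ℝ → E} {d : E} {a : ℝ} (hf : HasDerivAt f d a) (hg : HasDerivAt g d a)
    (hkf : Set.EqOn k f (Set.Iic a)) (hkg : Set.EqOn k g (Set.Ici a)) : HasDerivAt k d a := by
  have h := (hf.hasDerivWithinAt.congr hkf (hkf Set.self_mem_Iic)).union
    (hg.hasDerivWithinAt.congr hkg (hkg Set.self_mem_Ici))
  rwa [Set.Iic_union_Ici, hasDerivWithinAt_univ] at h

lemma SolvesAt.glue {T : ℝ} (hT : t₀ < T) (hQ : ∀ t ∈ Set.Ioo 0 T, SolvesAt μ Q t)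
    (hR : ∀ t ∈ Set.Ici t₀, SolvesAt μ R t) (h : Q t₀ = R t₀) {t : ℝ} (ht : 0 < t) :
    SolvesAt μ (glue t₀ Q R) t := by
  rcases lt_trichotomy t t₀ with htt | rfl | htt
  · refine (hQ t ⟨ht, htt.trans hT⟩).congr_of_eventuallyEq ?_
    filter_upwards [Iic_mem_nhds htt] with s hs using glue_of_le hs
  · have h1 := hQ t ⟨ht, hT⟩
    have h2 := hR t Set.self_mem_Ici
    have e := glue_of_le (Q := Q) (R := R) (le_refl t)
    refine ⟨e ▸ h1.add_ne, e ▸ h1.sub_ne, ?_, ?_⟩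
    · rw [e]
      refine h1.position.of_eqOn_halfLines (h ▸ h2.position) (fun s hs => ?_) fun s hs => ?_
      · simp only [glue_of_le (Set.mem_Iic.1 hs)]
      · simp only [glue_of_ge h (Set.mem_Ici.1 hs)]
    · rw [e]
      refine h1.momentum.of_eqOn_halfLines (h ▸ h2.momentum) (fun s hs => ?_) fun s hs => ?_
      · simp only [glue_of_le (Set.mem_Iic.1 hs)]
      · simp only [glue_of_ge h (Set.mem_Ici.1 hs)]
  · refine (hR t htt.le).congr_of_eventuallyEq ?_
    filter_upwards [Ici_mem_nhds htt] with s hs using glue_of_ge h hs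

end Gluing

section Symmetry

variable {μ : ℝ}

lemma ham_reflect (x y p₁ p₂ : ℝ) : Ham μ x (-y) (-p₁) p₂ = Ham μ x y p₁ p₂ := by
  simp only [Ham, dS, dJ, neg_sq]
  ring

/-- The time-reversing symmetry of the problem. -/
lemma IsPCRTBPSol.reflect {q1 q2 p1 p2 : ℝ → ℝ} {I : Set ℝ} (h : IsPCRTBPSol μ I q1 q2 p1 p2) :
    IsPCRTBPSol μ {t | -t ∈ I} (fun t => q1 (-t)) (fun t => -q2 (-t)) (fun t => -p1 (-t))
      (fun t => p2 (-t)) := by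
  intro t ht
  obtain ⟨⟨hS, hJ⟩, h1, h2, h3, h4⟩ := h (-t) ht
  have hdS : ∀ x y, dS μ x (-y) = dS μ x y := fun x y => by simp only [dS, neg_sq]
  have hdJ : ∀ x y, dJ μ x (-y) = dJ μ x y := fun x y => by simp only [dJ, neg_sq]
  have hneg := hasDerivAt_neg t
  refine ⟨⟨?_, ?_⟩, ?_, ?_, ?_, ?_⟩
  · simpa [Prod.ext_iff] using hS
  · simpa [Prod.ext_iff] using hJ
  · exact (h1.comp t hneg).congr_deriv (by ring)
  · exact (h2.comp t hneg).fun_neg.congr_deriv (by ring)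
  · simp only [hdS, hdJ]
    exact (h3.comp t hneg).fun_neg.congr_deriv (by ring)
  · simp only [hdS, hdJ]
    exact (h4.comp t hneg).congr_deriv (by ring)

end Symmetry

/-- For some energy of size `O(μ)`, the ejection orbit leaving the primary in the direction opposite
to the second primary is parabolic. -/
lemma exists_parabolic_ejection {μ : ℝ} (hμ : 0 < μ) (hμ' : μ < 1 / 100000000) :
    ∃ h : ℝ, |h| ≤ 4000 * μ ∧ ∃ Q : ℝ → ℂ × ℂ,
      (∀ t ∈ Set.Ioi 0, SolvesAt μ Q t ∧ complexHam μ (Q t) = h) ∧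
      Tendsto (fun t => (Q t).1) (𝓝[>] 0) (𝓝 (-μ)) ∧
      Tendsto (fun t => ‖(Q t).1‖) atTop atTop ∧ Tendsto (fun t => ‖(Q t).2‖) atTop (𝓝 0) := by
  have hμ'' : μ < 1 / 100 := by linarith
  obtain ⟨K, hK⟩ := exists_lipschitzWith_nearField μ
  obtain ⟨Φ, hΦ0, hΦ, hΦc⟩ := exists_continuous_flow hK
  have hS : ∀ h ∈ Set.Icc (-(4000 * μ)) (4000 * μ), IsEjection μ h (Φ (collisionState μ h)) :=
    fun h hh => isEjection_of_solution hμ hμ' (abs_le.2 hh) (hΦ0 _) (hΦ _)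
  have hcont : ContinuousOn (fun h => physicalState μ (Φ (collisionState μ h) 3))
      (Set.Icc (-(4000 * μ)) (4000 * μ)) := by
    intro h hh
    have hw := (hS h hh).position_ne_zero hμ hμ' (τ := 3) (by norm_num)
    have hstate : Continuous fun h => (collisionState μ h, (3 : ℝ)) := by
      unfold collisionState collisionEnergy
      fun_prop
    have hwb : conj (Φ (collisionState μ h) 3).1 ≠ 0 := by simpa using hw
    have hphys : ContinuousAt (physicalState μ) (Φ (collisionState μ h) 3) := by
      have := Complex.continuous_conj
      unfold physicalState
      refine ContinuousAt.prodMk (by fun_prop) (ContinuousAt.sub (ContinuousAt.mul (by fun_prop)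
        (ContinuousAt.div (by fun_prop) (Continuous.continuousAt (by fun_prop)) hwb)) (by fun_prop))
    exact (hphys.comp (f := fun h => Φ (collisionState μ h) 3)
      (hΦc.comp hstate).continuousAt).continuousWithinAt
  obtain ⟨h, hh, Y, hY0, hY, hY4, hYq, hYp⟩ := exists_parabolic_far hμ hμ'' (g := 3860 * μ)
    (by linarith) (by linarith) (by linarith) (by linarith)
    (fun h hh => abs_le.2 ⟨by linarith [hh.1], by linarith [hh.2]⟩) hcont
    (fun h hh => (hS h hh).isFarStart hμ hμ')
  obtain ⟨Q, t₀, T, ht0, hT, hQt, hQ, hQlim⟩ := (hS h hh).exists_physical hμ hμ'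
  set R : ℝ → ℂ × ℂ := fun t => Y (t - t₀) with hR
  have heq : Q t₀ = R t₀ := by simp only [hQt, hR, sub_self, hY0]
  have hRsol : ∀ t ∈ Set.Ici t₀, SolvesAt μ R t := fun t ht =>
    (solvesAt_far hμ hμ'' (hY _) (hY4 _ (sub_nonneg.2 ht))).comp_sub_const
  have hshift : Tendsto (fun t => t - t₀) atTop atTop :=
    tendsto_atTop_add_const_right _ _ tendsto_id
  have hlarge : ∀ᶠ t in atTop, glue t₀ Q R t = R t := by
    filter_upwards [eventually_ge_atTop t₀] with t ht using glue_of_ge heq ht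
  refine ⟨h, abs_le.2 hh, glue t₀ Q R, fun t ht => ⟨SolvesAt.glue hT (fun s hs => (hQ s hs).1) hRsol
    heq ht, ?_⟩, ?_, ?_, ?_⟩
  · rcases le_total t t₀ with htt | htt
    · rw [glue_of_le htt]
      exact (hQ t ⟨ht, htt.trans_lt hT⟩).2
    · rw [glue_of_ge heq htt]
      refine ((SolvesAt.isPCRTBPSol (I := Set.Icc t₀ t) fun s hs => hRsol s hs.1).ham_eq
        ⟨htt, le_rfl⟩).trans ?_
      rw [← heq]
      exact (hQ t₀ ⟨ht0, hT⟩).2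
  · refine hQlim.congr' ?_
    filter_upwards [Ioo_mem_nhdsGT ht0] with t ht
    rw [glue_of_le ht.2.le]
  · refine (hYq.comp hshift).congr' ?_
    filter_upwards [hlarge] with t ht
    rw [ht]
    rfl
  · refine (hYp.comp hshift).congr' ?_
    filter_upwards [hlarge] with t ht
    rw [ht]
    rfl

/-- There are `μ₀ > 0` and `c > 0` such that for every `μ ∈ (0,μ₀)` there is an energy `h`
with `|h| ≤ cμ` at which the PCRTBP has both a parabolic ejection orbit and a parabolic
collision orbit (with the first primary). -/
theorem parabolic_ejection_and_collision_orbits :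
    ∃ μ₀ : ℝ, 0 < μ₀ ∧ ∃ c : ℝ, 0 < c ∧
      ∀ μ ∈ Set.Ioo (0 : ℝ) μ₀,
        ∃ h : ℝ, |h| ≤ c * μ ∧
          -- (a) a parabolic ejection orbit
          (∃ (t0 : ℝ) (q1 q2 p1 p2 : ℝ → ℝ),
            IsPCRTBPSol μ (Set.Ioi t0) q1 q2 p1 p2 ∧
            (∀ t ∈ Set.Ioi t0, Ham μ (q1 t) (q2 t) (p1 t) (p2 t) = h) ∧
            Tendsto (fun t => (q1 t, q2 t)) (nhdsWithin t0 (Set.Ioi t0)) (𝓝 (-μ, 0)) ∧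
            Tendsto (fun t => nrm2 (q1 t) (q2 t)) atTop atTop ∧
            Tendsto (fun t => nrm2 (p1 t) (p2 t)) atTop (𝓝 0)) ∧
          -- (b) a parabolic collision orbit
          (∃ (t1 : ℝ) (q1 q2 p1 p2 : ℝ → ℝ),
            IsPCRTBPSol μ (Set.Iio t1) q1 q2 p1 p2 ∧
            (∀ t ∈ Set.Iio t1, Ham μ (q1 t) (q2 t) (p1 t) (p2 t) = h) ∧
            Tendsto (fun t => (q1 t, q2 t)) (nhdsWithin t1 (Set.Iio t1)) (𝓝 (-μ, 0)) ∧
            Tendsto (fun t => nrm2 (q1 t) (q2 t)) atBot atTop ∧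
            Tendsto (fun t => nrm2 (p1 t) (p2 t)) atBot (𝓝 0)) := by
  refine ⟨1 / 100000000, by norm_num, 4000, by norm_num, fun μ hμ => ?_⟩
  obtain ⟨h, hh, Q, hQ, hQ0, hQq, hQp⟩ := exists_parabolic_ejection hμ.1 hμ.2
  have hsol := SolvesAt.isPCRTBPSol fun t ht => (hQ t ht).1
  have hq0 : Tendsto (fun t => ((Q t).1.re, (Q t).1.im)) (𝓝[>] 0) (𝓝 (-μ, 0)) := by
    have hre := (Complex.continuous_re.tendsto _).comp hQ0
    have him := (Complex.continuous_im.tendsto _).comp hQ0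
    simpa using hre.prodMk_nhds him
  refine ⟨h, hh, ⟨0, fun t => (Q t).1.re, fun t => (Q t).1.im, fun t => (Q t).2.re,
    fun t => (Q t).2.im, hsol, fun t ht => (hQ t ht).2, hq0, ?_, ?_⟩,
    ⟨0, fun t => (Q (-t)).1.re, fun t => -(Q (-t)).1.im, fun t => -(Q (-t)).2.re,
    fun t => (Q (-t)).2.im, hsol.reflect.mono fun t ht => by simpa using ht,
    fun t ht => ?_, ?_, ?_, ?_⟩⟩
  · simpa only [nrm2_eq_norm] using hQq
  · simpa only [nrm2_eq_norm] using hQp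
  · rw [ham_reflect]
    exact (hQ (-t) (by simpa using ht)).2
  · have hneg : Tendsto (fun t : ℝ => -t) (𝓝[<] 0) (𝓝[>] 0) := by
      simpa using tendsto_neg_nhdsLT (a := (0 : ℝ))
    have hflip : Tendsto (fun x : ℝ × ℝ => (x.1, -x.2)) (𝓝 (-μ, 0)) (𝓝 (-μ, 0)) := by
      have : Continuous fun x : ℝ × ℝ => (x.1, -x.2) := by fun_prop
      simpa using this.tendsto (-μ, 0)
    exact hflip.comp (hq0.comp hneg)
  · have hn : ∀ x y, nrm2 x (-y) = nrm2 x y := fun x y => by simp only [nrm2, neg_sq]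
    simpa only [hn, nrm2_eq_norm, Function.comp_def] using hQq.comp tendsto_neg_atBot_atTop
  · have hn : ∀ x y, nrm2 (-x) y = nrm2 x y := fun x y => by simp only [nrm2, neg_sq]
    simpa only [hn, nrm2_eq_norm, Function.comp_def] using hQp.comp tendsto_neg_atBot_atTop
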